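/- (Lemma 2.2, uniqueness part) Let k > 0, let D ⊂ ℝ³ be a bounded open set containing the origin, and let K² : ℝ³ → ℂ be twice continuously differentiable with K²(x) ≠ 0 for all x, K²(x) = k² for x ∉ D, Im K²(x) ≥ 0 for all x, and ∇K² = 0 on the boundary of D. Set p := K² − k² and q := ∇K²/K². If E : ℝ³ → ℂ³ is twice continuously differentiable and satisfies the homogeneous integral equation E(x) = ∫_D g(x,y) p(y) E(y) dy + ∇ₓ ∫_D g(x,y) q(y)·E(y) dy for all x ∈ ℝ³, then E ≡ 0. -/

import Mathlib

/- STATEMENT 11 (Lemma 2.2, uniqueness part): Under the stated assumptions on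
K² and D, the homogeneous integral equation
E(x) = ∫_D g(x,y) p(y) E(y) dy + ∇ₓ ∫_D g(x,y) q(y)·E(y) dy
(for all x ∈ ℝ³) has only the trivial C² solution E ≡ 0. -/

noncomputable section

open Real Complex MeasureTheory

abbrev R3 : Type := EuclideanSpace ℝ (Fin 3)

/-- Partial derivative ∂ᵢ of a scalar function. -/
def pd (i : Fin 3) (f : R3 → ℂ) (x : R3) : ℂ :=
  fderiv ℝ f x (EuclideanSpace.single i (1 : ℝ))

/-- Bilinear dot product of complex vectors (no conjugation). -/
def dotc (u v : Fin 3 → ℂ) : ℂ := ∑ i, u i * v i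

/-- Gradient of a scalar function. -/
def grad (f : R3 → ℂ) (x : R3) : Fin 3 → ℂ := fun i => pd i f x

/-- The weakly singular kernel g(x,y) = e^{ik|x−y|}/(4π|x−y|). -/
def g (k : ℝ) (x y : R3) : ℂ :=
  Complex.exp (Complex.I * (k : ℂ) * (‖x - y‖ : ℝ)) / (4 * (Real.pi : ℂ) * (‖x - y‖ : ℝ))

open scoped Topology ContDiff Convolution

/-- The outgoing fundamental solution of the Helmholtz equation. -/
def helmholtzKernel (k : ℝ) (z : R3) : ℂ :=
  Complex.exp (Complex.I * (k : ℂ) * (‖z‖ : ℝ)) / (4 * (Real.pi : ℂ) * (‖z‖ : ℝ))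

/-- The volume potential with density `f`. -/
def volumePotential (k : ℝ) (f : R3 → ℂ) (x : R3) : ℂ := ∫ y, g k x y * f y

lemma g_eq_helmholtzKernel (k : ℝ) (x y : R3) : g k x y = helmholtzKernel k (x - y) := rfl

lemma norm_exp_I_mul_ofReal_mul (a b : ℝ) : ‖Complex.exp (Complex.I * (a : ℂ) * (b : ℂ))‖ = 1 := by
  rw [show Complex.I * (a : ℂ) * (b : ℂ) = ((a * b : ℝ) : ℂ) * Complex.I by push_cast; ring]
  exact Complex.norm_exp_ofReal_mul_I _

lemma norm_helmholtzKernel (k : ℝ) (z : R3) : ‖helmholtzKernel k z‖ = 1 / (4 * Real.pi * ‖z‖) := by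
  have h : (4 * (Real.pi : ℂ) * (‖z‖ : ℝ)) = ((4 * Real.pi * ‖z‖ : ℝ) : ℂ) := by push_cast; ring
  rw [helmholtzKernel, norm_div, norm_exp_I_mul_ofReal_mul, h, Complex.norm_of_nonneg]
  positivity

lemma measurable_helmholtzKernel (k : ℝ) : Measurable (helmholtzKernel k) := by
  unfold helmholtzKernel; fun_prop

lemma integrableOn_inv_norm_ball (r : ℝ) :
    IntegrableOn (fun z : R3 => ‖z‖⁻¹) (Metric.ball 0 r) := by
  rw [integrableOn_fun_norm_addHaar volume (f := fun r => r⁻¹)]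
  have hd : Module.finrank ℝ R3 - 1 = 2 := by simp
  rw [hd]
  have h1 : IntegrableOn (fun y : ℝ => y) (Set.Ioo 0 r) :=
    (continuous_id.integrableOn_Icc).mono_set Set.Ioo_subset_Icc_self
  refine h1.congr_fun (fun y hy => ?_) measurableSet_Ioo
  have : y ≠ 0 := hy.1.ne'
  simp only [smul_eq_mul]
  field_simp

lemma integrableOn_helmholtzKernel (k r : ℝ) :
    IntegrableOn (helmholtzKernel k) (Metric.ball 0 r) := by
  refine Integrable.mono ((integrableOn_inv_norm_ball r).const_mul (1 / (4 * Real.pi)))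
    (measurable_helmholtzKernel k).aestronglyMeasurable (Filter.Eventually.of_forall fun z => ?_)
  rw [norm_helmholtzKernel, Real.norm_of_nonneg (by positivity)]
  apply le_of_eq
  field_simp

lemma locallyIntegrable_helmholtzKernel (k : ℝ) : LocallyIntegrable (helmholtzKernel k) := by
  intro x
  refine ⟨Metric.ball 0 (‖x‖ + 1), Metric.isOpen_ball.mem_nhds (by simp), ?_⟩
  exact integrableOn_helmholtzKernel k _

lemma volumePotential_eq_convolution (k : ℝ) (f : R3 → ℂ) :
    volumePotential k f = (helmholtzKernel k ⋆[ContinuousLinearMap.mul ℝ ℂ, volume] f) := by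
  funext x
  rw [volumePotential, convolution_def,
    ← integral_sub_left_eq_self (fun y => g k x y * f y) volume x]
  simp [g_eq_helmholtzKernel]

lemma volumePotential_eq_integral_sub (k : ℝ) (f : R3 → ℂ) (x : R3) :
    volumePotential k f x = ∫ t, helmholtzKernel k t * f (x - t) := by
  rw [volumePotential_eq_convolution, convolution_def]; simp

lemma HasCompactSupport.integrable_helmholtzKernel_mul {k : ℝ} {f : R3 → ℂ}
    (hc : HasCompactSupport f)
    (hf : Continuous f) : Integrable (fun t => helmholtzKernel k t * f t) := by
  simpa [mul_comm, smul_eq_mul] using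
    (locallyIntegrable_helmholtzKernel k).integrable_smul_left_of_hasCompactSupport hf hc

lemma HasCompactSupport.integrable_g_mul {k : ℝ} {f : R3 → ℂ} (hc : HasCompactSupport f)
    (hf : Continuous f) (x : R3) : Integrable (fun y => g k x y * f y) := by
  have h := (hc.comp_homeomorph (Homeomorph.subLeft x)).integrable_helmholtzKernel_mul (k := k)
    (hf.comp (Homeomorph.subLeft x).continuous)
  simpa [g_eq_helmholtzKernel] using h.comp_sub_left x

lemma HasCompactSupport.contDiff_volumePotential {k : ℝ} {f : R3 → ℂ} {n : ℕ∞}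
    (hc : HasCompactSupport f) (hf : ContDiff ℝ n f) : ContDiff ℝ n (volumePotential k f) := by
  rw [volumePotential_eq_convolution]
  exact hc.contDiff_convolution_right _ (locallyIntegrable_helmholtzKernel k) hf

lemma HasCompactSupport.continuous_volumePotential {k : ℝ} {f : R3 → ℂ}
    (hc : HasCompactSupport f) (hf : Continuous f) : Continuous (volumePotential k f) := by
  rw [volumePotential_eq_convolution]
  exact hc.continuous_convolution_right _ (locallyIntegrable_helmholtzKernel k) hf

lemma HasCompactSupport.pd_volumePotential {k : ℝ} {f : R3 → ℂ}
    (hc : HasCompactSupport f) (hf : ContDiff ℝ 1 f) (i : Fin 3) :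
    pd i (volumePotential k f) = volumePotential k (pd i f) := by
  funext x
  rw [pd, volumePotential_eq_convolution, (hc.hasFDerivAt_convolution_right _
    (locallyIntegrable_helmholtzKernel k) hf x).fderiv, volumePotential_eq_integral_sub]
  rw [convolution_def, ContinuousLinearMap.integral_apply]
  · simp [pd]
  · exact ((hc.fderiv ℝ).convolutionExists_right _ (locallyIntegrable_helmholtzKernel k)
      (hf.continuous_fderiv one_ne_zero) x)

lemma volumePotential_add {k : ℝ} {f h : R3 → ℂ} (hf : HasCompactSupport f) (hf' : Continuous f)
    (hh : HasCompactSupport h) (hh' : Continuous h) :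
    volumePotential k (fun x => f x + h x) =
      fun x => volumePotential k f x + volumePotential k h x := by
  funext x
  simp only [volumePotential, mul_add]
  exact integral_add (hf.integrable_g_mul hf' x) (hh.integrable_g_mul hh' x)

lemma volumePotential_const_mul (k : ℝ) (c : ℂ) (f : R3 → ℂ) :
    volumePotential k (fun x => c * f x) = fun x => c * volumePotential k f x := by
  funext x
  simp only [volumePotential, mul_left_comm _ c]
  exact integral_const_mul _ _

lemma volumePotential_sum {ι : Type*} (s : Finset ι) {k : ℝ} {f : ι → R3 → ℂ}
    (hf : ∀ i, HasCompactSupport (f i)) (hf' : ∀ i, Continuous (f i)) :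
    volumePotential k (fun x => ∑ i ∈ s, f i x) = fun x => ∑ i ∈ s, volumePotential k (f i) x := by
  funext x
  simp only [volumePotential, Finset.mul_sum]
  exact integral_finsetSum _ fun i _ => (hf i).integrable_g_mul (hf' i) x

/-! ### Partial derivatives -/

lemma ContDiff.pd {n m : WithTop ℕ∞} {f : R3 → ℂ} (hf : ContDiff ℝ n f) (i : Fin 3) (h : m + 1 ≤ n) :
    ContDiff ℝ m (pd i f) :=
  (hf.fderiv_right h).clm_apply contDiff_const

lemma ContDiff.continuous_pd {n : WithTop ℕ∞} {f : R3 → ℂ} (hf : ContDiff ℝ n f) (i : Fin 3)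
    (h : n ≠ 0) : Continuous (_root_.pd i f) :=
  (hf.continuous_fderiv h).clm_apply continuous_const

lemma HasCompactSupport.pd {f : R3 → ℂ} (hf : HasCompactSupport f) (i : Fin 3) :
    HasCompactSupport (pd i f) :=
  (hf.fderiv ℝ).mono' (by
    intro x hx
    apply subset_tsupport
    intro h0
    apply hx
    simp [_root_.pd, h0])

lemma pd_add {f h : R3 → ℂ} {x : R3} (hf : DifferentiableAt ℝ f x) (hh : DifferentiableAt ℝ h x)
    (i : Fin 3) : pd i (fun y => f y + h y) x = pd i f x + pd i h x := by
  simp [pd, fderiv_fun_add hf hh]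

lemma pd_neg (f : R3 → ℂ) (x : R3) (i : Fin 3) : pd i (fun y => -f y) x = -pd i f x := by
  simp [pd, fderiv_fun_neg]

lemma pd_mul {f h : R3 → ℂ} {x : R3} (hf : DifferentiableAt ℝ f x) (hh : DifferentiableAt ℝ h x)
    (i : Fin 3) : pd i (fun y => f y * h y) x = f x * pd i h x + pd i f x * h x := by
  simp [pd, fderiv_fun_mul hf hh, mul_comm]

lemma pd_const_mul {f : R3 → ℂ} {x : R3} (hf : DifferentiableAt ℝ f x) (c : ℂ)
    (i : Fin 3) : pd i (fun y => c * f y) x = c * pd i f x := by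
  simp [pd, fderiv_const_mul hf]

lemma pd_sum {ι : Type*} (s : Finset ι) {f : ι → R3 → ℂ} {x : R3}
    (hf : ∀ j, DifferentiableAt ℝ (f j) x) (i : Fin 3) :
    pd i (fun y => ∑ j ∈ s, f j y) x = ∑ j ∈ s, pd i (f j) x := by
  simp [pd, fderiv_fun_sum fun j _ => hf j]

/-- Integration by parts with a compactly supported factor. -/
lemma integral_mul_pd {f h : R3 → ℂ} (hf : ContDiff ℝ 1 f) (hh : ContDiff ℝ 1 h)
    (hc : HasCompactSupport h) (i : Fin 3) :
    ∫ x, f x * pd i h x = -∫ x, pd i f x * h x := by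
  apply integral_mul_fderiv_eq_neg_fderiv_mul_of_integrable
  · exact ((hf.continuous_pd i one_ne_zero).mul hh.continuous).integrable_of_hasCompactSupport
      hc.mul_left
  · exact (hf.continuous.mul (hh.continuous_pd i one_ne_zero)).integrable_of_hasCompactSupport
      (hc.pd i).mul_left
  · exact (hf.continuous.mul hh.continuous).integrable_of_hasCompactSupport hc.mul_left
  · exact fun x _ => hf.differentiable one_ne_zero x
  · exact fun x _ => hh.differentiable one_ne_zero x

/-- The Laplacian, as a sum of second partial derivatives. -/
def laplace (f : R3 → ℂ) (x : R3) : ℂ := ∑ i, pd i (pd i f) x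

lemma ContDiff.continuous_laplace {f : R3 → ℂ} (hf : ContDiff ℝ 2 f) : Continuous (laplace f) :=
  continuous_finsetSum _ fun i _ => (hf.pd i (m := 1) (by norm_num)).continuous_pd i one_ne_zero

lemma HasCompactSupport.laplace {f : R3 → ℂ} (hf : HasCompactSupport f) :
    HasCompactSupport (laplace f) := by
  have h : _root_.laplace f = fun x => _root_.pd 0 (_root_.pd 0 f) x + _root_.pd 1 (_root_.pd 1 f) x
      + _root_.pd 2 (_root_.pd 2 f) x := by
    funext x; simp [_root_.laplace, Fin.sum_univ_three]
  rw [h]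
  exact (((hf.pd 0).pd 0).add ((hf.pd 1).pd 1)).add ((hf.pd 2).pd 2)

/-- Green's second identity with a compactly supported factor. -/
lemma integral_mul_laplace {f h : R3 → ℂ} (hf : ContDiff ℝ 2 f) (hh : ContDiff ℝ 2 h)
    (hc : HasCompactSupport h) :
    ∫ x, f x * laplace h x = ∫ x, laplace f x * h x := by
  have hf1 : ∀ i, ContDiff ℝ 1 (pd i f) := fun i => hf.pd i (by norm_num)
  have hh1 : ∀ i, ContDiff ℝ 1 (pd i h) := fun i => hh.pd i (by norm_num)
  simp only [laplace, Finset.mul_sum, Finset.sum_mul]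
  rw [integral_finsetSum, integral_finsetSum]
  · refine Finset.sum_congr rfl fun i _ => ?_
    rw [integral_mul_pd (hf.of_le one_le_two) (hh1 i) (hc.pd i), integral_mul_pd (hf1 i)
      (hh.of_le one_le_two) hc, neg_neg]
  · exact fun i _ => (((hf1 i).continuous_pd i one_ne_zero).mul
      hh.continuous).integrable_of_hasCompactSupport hc.mul_left
  · exact fun i _ => (hf.continuous.mul ((hh1 i).continuous_pd i
      one_ne_zero)).integrable_of_hasCompactSupport ((hc.pd i).pd i).mul_left

/-! ### A Carleman estimate with a convex quadratic weight -/

/-- Partial derivative of a real-valued function. -/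
def pdr (i : Fin 3) (f : R3 → ℝ) (x : R3) : ℝ := fderiv ℝ f x (EuclideanSpace.single i (1 : ℝ))

/-- The Laplacian of a real-valued function. -/
def laplaceReal (f : R3 → ℝ) (x : R3) : ℝ := ∑ i, pdr i (pdr i f) x

lemma ContDiff.pdr {n m : WithTop ℕ∞} {f : R3 → ℝ} (hf : ContDiff ℝ n f) (i : Fin 3)
    (h : m + 1 ≤ n) : ContDiff ℝ m (pdr i f) :=
  (hf.fderiv_right h).clm_apply contDiff_const

lemma ContDiff.continuous_pdr {n : WithTop ℕ∞} {f : R3 → ℝ} (hf : ContDiff ℝ n f) (i : Fin 3)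
    (h : n ≠ 0) : Continuous (_root_.pdr i f) :=
  (hf.continuous_fderiv h).clm_apply continuous_const

lemma HasCompactSupport.pdr {f : R3 → ℝ} (hf : HasCompactSupport f) (i : Fin 3) :
    HasCompactSupport (pdr i f) :=
  (hf.fderiv ℝ).mono' (by
    intro x hx
    apply subset_tsupport
    intro h0
    apply hx
    simp [_root_.pdr, h0])

lemma HasCompactSupport.laplaceReal {f : R3 → ℝ} (hf : HasCompactSupport f) :
    HasCompactSupport (laplaceReal f) := by
  have h : _root_.laplaceReal f = fun x => _root_.pdr 0 (_root_.pdr 0 f) x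
      + _root_.pdr 1 (_root_.pdr 1 f) x + _root_.pdr 2 (_root_.pdr 2 f) x := by
    funext x; simp [_root_.laplaceReal, Fin.sum_univ_three]
  rw [h]
  exact (((hf.pdr 0).pdr 0).add ((hf.pdr 1).pdr 1)).add ((hf.pdr 2).pdr 2)

lemma ContDiff.continuous_laplaceReal {f : R3 → ℝ} (hf : ContDiff ℝ 2 f) :
    Continuous (_root_.laplaceReal f) :=
  continuous_finsetSum _ fun i _ => (hf.pdr i (m := 1) (by norm_num)).continuous_pdr i one_ne_zero

lemma pdr_add {f h : R3 → ℝ} {x : R3} (hf : DifferentiableAt ℝ f x) (hh : DifferentiableAt ℝ h x)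
    (i : Fin 3) : pdr i (fun y => f y + h y) x = pdr i f x + pdr i h x := by
  simp [pdr, fderiv_fun_add hf hh]

lemma pdr_mul {f h : R3 → ℝ} {x : R3} (hf : DifferentiableAt ℝ f x) (hh : DifferentiableAt ℝ h x)
    (i : Fin 3) : pdr i (fun y => f y * h y) x = f x * pdr i h x + pdr i f x * h x := by
  simp [pdr, fderiv_fun_mul hf hh, mul_comm]

lemma pdr_const_mul {f : R3 → ℝ} {x : R3} (hf : DifferentiableAt ℝ f x) (c : ℝ)
    (i : Fin 3) : pdr i (fun y => c * f y) x = c * pdr i f x := by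
  simp [pdr, fderiv_const_mul hf]

lemma pdr_comm {f : R3 → ℝ} (hf : ContDiff ℝ 2 f) (i j : Fin 3) (x : R3) :
    pdr i (pdr j f) x = pdr j (pdr i f) x := by
  have hd : DifferentiableAt ℝ (fderiv ℝ f) x :=
    (hf.fderiv_right (m := 1) (by norm_num)).differentiable one_ne_zero x
  have key : ∀ v w : R3, fderiv ℝ (fun y => fderiv ℝ f y v) x w = fderiv ℝ (fderiv ℝ f) x w v := by
    intro v w
    rw [fderiv_clm_apply hd (differentiableAt_const v)]
    simp
  have hs : IsSymmSndFDerivAt ℝ f x := hf.contDiffAt.isSymmSndFDerivAt (by simp)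
  simp only [pdr]
  erw [key, key]
  exact hs _ _

lemma pdr_coord (c : ℝ) (i : Fin 3) (x : R3) :
    pdr i (fun y : R3 => y 0 + c) x = if i = 0 then 1 else 0 := by
  have h : HasFDerivAt (fun y : R3 => y 0 + c) (EuclideanSpace.proj (𝕜 := ℝ) (0 : Fin 3)) x :=
    (EuclideanSpace.proj (𝕜 := ℝ) (0 : Fin 3)).hasFDerivAt.add_const c
  rw [pdr, h.fderiv]
  simp [eq_comm]

lemma contDiff_coord {n : WithTop ℕ∞} (c : ℝ) : ContDiff ℝ n (fun y : R3 => y 0 + c) :=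
  (EuclideanSpace.proj (𝕜 := ℝ) (0 : Fin 3)).contDiff.add contDiff_const

lemma integral_pdr_eq_zero {w : R3 → ℝ} (hw : ContDiff ℝ 1 w) (hc : HasCompactSupport w) (i : Fin 3) :
    ∫ x, pdr i w x = 0 := by
  have h1 : Integrable (pdr i w) :=
    (hw.continuous_pdr i one_ne_zero).integrable_of_hasCompactSupport (hc.pdr i)
  have h2 : Integrable w := hw.continuous.integrable_of_hasCompactSupport hc
  have := integral_mul_fderiv_eq_neg_fderiv_mul_of_integrable (μ := (volume : Measure R3))
    (f := fun _ : R3 => (1 : ℝ)) (g := w) (v := EuclideanSpace.single i (1 : ℝ))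
    (by simp) (by simpa using! h1) (by simpa using h2)
    (fun x _ => differentiableAt_const _) (fun x _ => hw.differentiable one_ne_zero x)
  simpa [pdr] using this

/-- The flux whose divergence is the exact part of the conjugated Carleman identity. -/
def carlemanFlux (τ c : ℝ) (v : R3 → ℝ) (j : Fin 3) (x : R3) : ℝ :=
  -12 * τ * ((x 0 + c) * (pdr 0 v x * pdr j v x)) + -8 * τ * (v x * pdr j v x)
    + (if j = 0 then 6 * τ else 0) * ((x 0 + c) * (pdr 0 v x * pdr 0 v x + pdr 1 v x * pdr 1 v x
      + pdr 2 v x * pdr 2 v x))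
    + (if j = 0 then -6 * τ ^ 3 else 0) * ((x 0 + c) * ((x 0 + c) * ((x 0 + c) * (v x * v x))))

lemma contDiff_carlemanFlux {τ c : ℝ} {v : R3 → ℝ} (hv : ContDiff ℝ 2 v) (j : Fin 3) :
    ContDiff ℝ 1 (carlemanFlux τ c v j) := by
  have h0 : ContDiff ℝ 1 v := hv.of_le one_le_two
  have h1 : ∀ i, ContDiff ℝ 1 (pdr i v) := fun i => hv.pdr i (by norm_num)
  have hs : ContDiff ℝ 1 (fun y : R3 => y 0 + c) := contDiff_coord c
  unfold carlemanFlux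
  exact (((contDiff_const.mul (hs.mul ((h1 0).mul (h1 j)))).add
    (contDiff_const.mul (h0.mul (h1 j)))).add (contDiff_const.mul (hs.mul
    ((((h1 0).mul (h1 0)).add ((h1 1).mul (h1 1))).add ((h1 2).mul (h1 2)))))).add
    (contDiff_const.mul (hs.mul (hs.mul (hs.mul (h0.mul h0)))))

lemma hasCompactSupport_carlemanFlux {τ c : ℝ} {v : R3 → ℝ} (hc : HasCompactSupport v) (j : Fin 3) :
    HasCompactSupport (carlemanFlux τ c v j) := by
  unfold carlemanFlux
  exact ((((((hc.pdr 0).mul_right).mul_left).mul_left).add ((hc.mul_right).mul_left)).add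
    (((((hc.pdr 0).mul_right.add (hc.pdr 1).mul_right).add (hc.pdr 2).mul_right).mul_left).mul_left)).add
    (((((hc.mul_right).mul_left).mul_left).mul_left).mul_left)

lemma pdr_carlemanFlux {τ c : ℝ} {v : R3 → ℝ} (hv : ContDiff ℝ 2 v) (j : Fin 3) (x : R3) :
    pdr j (carlemanFlux τ c v j) x =
      -12 * τ * ((x 0 + c) * (pdr 0 v x * pdr j (pdr j v) x + pdr j (pdr 0 v) x * pdr j v x)
        + (if j = 0 then 1 else 0) * (pdr 0 v x * pdr j v x))
      + -8 * τ * (v x * pdr j (pdr j v) x + pdr j v x * pdr j v x)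
      + (if j = 0 then 6 * τ else 0) * ((x 0 + c) * (2 * pdr 0 v x * pdr j (pdr 0 v) x
          + 2 * pdr 1 v x * pdr j (pdr 1 v) x + 2 * pdr 2 v x * pdr j (pdr 2 v) x)
        + (pdr 0 v x * pdr 0 v x + pdr 1 v x * pdr 1 v x + pdr 2 v x * pdr 2 v x))
      + (if j = 0 then -6 * τ ^ 3 else 0) * (2 * (x 0 + c) ^ 3 * v x * pdr j v x
        + 3 * (x 0 + c) ^ 2 * (v x * v x)) := by
  have h0 : Differentiable ℝ v := hv.differentiable two_ne_zero
  have h1 : ∀ i, Differentiable ℝ (pdr i v) := fun i =>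
    (hv.pdr i (m := 1) (by norm_num)).differentiable one_ne_zero
  have hs : Differentiable ℝ (fun y : R3 => y 0 + c) := (contDiff_coord (n := 1) c).differentiable
    one_ne_zero
  have e : carlemanFlux τ c v j = fun x => -12 * τ * ((x 0 + c) * (pdr 0 v x * pdr j v x))
    + -8 * τ * (v x * pdr j v x)
    + (if j = 0 then 6 * τ else 0) * ((x 0 + c) * (pdr 0 v x * pdr 0 v x + pdr 1 v x * pdr 1 v x
      + pdr 2 v x * pdr 2 v x))
    + (if j = 0 then -6 * τ ^ 3 else 0) * ((x 0 + c) * ((x 0 + c) * ((x 0 + c) * (v x * v x)))) := rfl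
  have d00 := (h1 0).fun_mul (h1 0)
  have d11 := (h1 1).fun_mul (h1 1)
  have d22 := (h1 2).fun_mul (h1 2)
  have d0j := (h1 0).fun_mul (h1 j)
  have dvv := h0.fun_mul h0
  have dvj := h0.fun_mul (h1 j)
  have dn := (d00.fun_add d11).fun_add d22
  have ds1 := hs.fun_mul dvv
  have ds2 := hs.fun_mul ds1
  have ds3 := hs.fun_mul ds2
  have dsn := hs.fun_mul dn
  have ds0 := hs.fun_mul d0j
  rw [e, pdr_add ((((ds0.const_mul _).fun_add (dvj.const_mul _)).fun_add (dsn.const_mul _)) x)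
      ((ds3.const_mul _) x), pdr_add (((ds0.const_mul _).fun_add (dvj.const_mul _)) x)
      ((dsn.const_mul _) x), pdr_add ((ds0.const_mul _) x) ((dvj.const_mul _) x),
    pdr_const_mul (ds0 x), pdr_const_mul (dvj x), pdr_const_mul (dsn x), pdr_const_mul (ds3 x),
    pdr_mul (hs x) (d0j x), pdr_mul (h1 0 x) (h1 j x), pdr_mul (h0 x) (h1 j x),
    pdr_mul (hs x) (dn x), pdr_add ((d00.fun_add d11) x) (d22 x), pdr_add (d00 x) (d11 x),
    pdr_mul (h1 0 x) (h1 0 x), pdr_mul (h1 1 x) (h1 1 x), pdr_mul (h1 2 x) (h1 2 x),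
    pdr_mul (hs x) (ds2 x), pdr_mul (hs x) (ds1 x), pdr_mul (hs x) (dvv x), pdr_mul (h0 x) (h0 x),
    pdr_coord]
  split_ifs <;> ring

lemma carleman_pointwise {τ s v v0 v1 v2 L : ℝ} (hτ : 1 ≤ τ) (hs : v = 0 ∨ 1 ≤ s)  :
    -12 * τ * (s * v0 * L + v0 * v0) - 8 * τ * (v * L + (v0 * v0 + v1 * v1 + v2 * v2))
      + 6 * τ * (v0 * v0 + v1 * v1 + v2 * v2)
      - 6 * τ ^ 3 * (2 * s ^ 3 * v * v0 + 3 * s ^ 2 * (v * v))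
    ≤ 3 * (L - 2 * τ * s * v0 + (τ ^ 2 * s ^ 2 - τ) * v) ^ 2
      - τ * (v ^ 2 + ((v0 - τ * s * v) ^ 2 + v1 ^ 2 + v2 ^ 2)) := by
  have hsv : v ^ 2 ≤ s ^ 2 * v ^ 2 := by
    rcases hs with h | h
    · simp [h]
    · have h1 : 1 ≤ s ^ 2 := by nlinarith
      nlinarith [mul_nonneg (sub_nonneg.2 h1) (sq_nonneg v)]
  have h3 : τ ^ 2 * (s ^ 2 * v ^ 2) ≤ τ ^ 3 * (s ^ 2 * v ^ 2) :=
    mul_le_mul_of_nonneg_right (by nlinarith [sq_nonneg τ]) (by positivity)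
  have h2 : τ ^ 2 * v ^ 2 ≤ τ ^ 2 * (s ^ 2 * v ^ 2) :=
    mul_le_mul_of_nonneg_left hsv (by positivity)
  have h1 : τ * v ^ 2 ≤ τ ^ 2 * v ^ 2 :=
    mul_le_mul_of_nonneg_right (by nlinarith) (by positivity)
  have h4 : 0 ≤ τ ^ 3 * (s ^ 2 * v ^ 2) := by positivity
  nlinarith [sq_nonneg (2 * τ * s * v0 + τ * v), sq_nonneg (L + τ ^ 2 * s ^ 2 * v),
    sq_nonneg (L + τ ^ 2 * s ^ 2 * v + τ * v), mul_nonneg (by linarith : 0 ≤ τ) (sq_nonneg v0),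
    mul_nonneg (by linarith : 0 ≤ τ) (sq_nonneg v1), mul_nonneg (by linarith : 0 ≤ τ) (sq_nonneg v2),
    mul_nonneg (by linarith : 0 ≤ τ) (sq_nonneg (v0 + τ * s * v))]

lemma contDiff_gaussWeight {n : WithTop ℕ∞} (τ c : ℝ) :
    ContDiff ℝ n (fun y : R3 => Real.exp (τ / 2 * (y 0 + c) ^ 2)) :=
  Real.contDiff_exp.comp (contDiff_const.mul ((contDiff_coord c).pow 2))

lemma pdr_gaussWeight (τ c : ℝ) (i : Fin 3) (x : R3) :
    pdr i (fun y : R3 => Real.exp (τ / 2 * (y 0 + c) ^ 2)) x =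
      (if i = 0 then τ * (x 0 + c) else 0) * Real.exp (τ / 2 * (x 0 + c) ^ 2) := by
  have h : HasFDerivAt (fun y : R3 => y 0 + c) (EuclideanSpace.proj (𝕜 := ℝ) (0 : Fin 3)) x :=
    (EuclideanSpace.proj (𝕜 := ℝ) (0 : Fin 3)).hasFDerivAt.add_const c
  rw [pdr, (((h.pow 2).const_mul (τ / 2)).exp).fderiv]
  simp
  split_ifs with h1 h2 h2
  · ring
  · exact absurd h1.symm h2
  · exact absurd h2.symm h1
  · simp

/-- The Carleman estimate with weight `exp (τ (x₀ + c)² / 2)`. -/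
lemma carleman_estimate {τ c : ℝ} (hτ : 1 ≤ τ) {u : R3 → ℝ} (hu : ContDiff ℝ 2 u)
    (hc : HasCompactSupport u) (hs : ∀ x, u x ≠ 0 → 1 ≤ x 0 + c) :
    τ * ∫ x, Real.exp (τ * (x 0 + c) ^ 2) * (u x ^ 2 + ∑ i, pdr i u x ^ 2) ≤
      3 * ∫ x, Real.exp (τ * (x 0 + c) ^ 2) * laplaceReal u x ^ 2 := by
  set W : R3 → ℝ := fun y => Real.exp (τ / 2 * (y 0 + c) ^ 2) with hW
  have hWW : ∀ x : R3, Real.exp (τ * (x 0 + c) ^ 2) = W x * W x := fun x => by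
    rw [hW]; simp only; rw [← Real.exp_add]; congr 1; ring
  have hWd : ContDiff ℝ 2 W := contDiff_gaussWeight τ c
  set v : R3 → ℝ := fun x => W x * u x with hv
  have hvd : ContDiff ℝ 2 v := hWd.mul hu
  have hvc : HasCompactSupport v := hc.mul_left
  have hpW : ∀ i, pdr i W = fun x => (if i = 0 then τ * (x 0 + c) else 0) * W x := fun i =>
    funext fun x => pdr_gaussWeight τ c i x
  have hW1 : Differentiable ℝ W := hWd.differentiable two_ne_zero
  have hu1 : Differentiable ℝ u := hu.differentiable two_ne_zero
  have hui : ∀ i, Differentiable ℝ (pdr i u) := fun i =>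
    (hu.pdr i (m := 1) (by norm_num)).differentiable one_ne_zero
  have hs1 : Differentiable ℝ (fun y : R3 => y 0 + c) := (contDiff_coord (n := 1) c).differentiable
    one_ne_zero
  have e0 : pdr 0 v = fun x => W x * pdr 0 u x + (τ * ((x 0 + c) * (W x * u x))) := by
    funext x
    rw [hv, pdr_mul (hW1 x) (hu1 x), hpW]
    simp; ring
  have e0x : ∀ x, pdr 0 v x = W x * pdr 0 u x + (τ * ((x 0 + c) * (W x * u x))) := fun x => by rw [e0]
  have hvx : ∀ x, v x = W x * u x := fun _ => rfl
  have ej : ∀ j, j ≠ 0 → pdr j v = fun x => W x * pdr j u x := by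
    intro j hj
    funext x
    rw [hv, pdr_mul (hW1 x) (hu1 x), hpW]
    simp [hj]
  have e00 : ∀ x, pdr 0 (pdr 0 v) x = W x * pdr 0 (pdr 0 u) x + 2 * τ * (x 0 + c) * (W x * pdr 0 u x)
      + (τ + τ ^ 2 * (x 0 + c) ^ 2) * (W x * u x) := by
    intro x
    have d1 := hW1.fun_mul (hui 0)
    have d2 := hW1.fun_mul hu1
    have d3 := hs1.fun_mul d2
    rw [e0, pdr_add (d1 x) ((d3.const_mul τ) x), pdr_const_mul (d3 x), pdr_mul (hs1 x) (d2 x),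
      pdr_mul (hW1 x) (hu1 x), pdr_mul (hW1 x) (hui 0 x), pdr_coord, hpW]
    simp; ring
  have ejj : ∀ j, j ≠ 0 → ∀ x, pdr j (pdr j v) x = W x * pdr j (pdr j u) x := by
    intro j hj x
    rw [ej j hj, pdr_mul (hW1 x) (hui j x), hpW]
    simp [hj]
  have hpt : ∀ x, ∑ j, pdr j (carlemanFlux τ c v j) x ≤
      3 * (Real.exp (τ * (x 0 + c) ^ 2) * laplaceReal u x ^ 2)
        - τ * (Real.exp (τ * (x 0 + c) ^ 2) * (u x ^ 2 + ∑ i, pdr i u x ^ 2)) := by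
    intro x
    have hsx : v x = 0 ∨ 1 ≤ x 0 + c := by
      by_cases h : u x = 0
      · left; simp [hv, h]
      · right; exact hs x h
    have key := carleman_pointwise (v0 := pdr 0 v x) (v1 := pdr 1 v x) (v2 := pdr 2 v x)
      (L := laplaceReal v x) hτ hsx
    have hL : laplaceReal v x - 2 * τ * (x 0 + c) * pdr 0 v x
        + (τ ^ 2 * (x 0 + c) ^ 2 - τ) * v x = W x * laplaceReal u x := by
      simp only [laplaceReal, Fin.sum_univ_three, e00, ejj 1 (by decide), ejj 2 (by decide), e0x, hvx]
      ring
    have h0 : pdr 0 v x - τ * (x 0 + c) * v x = W x * pdr 0 u x := by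
      rw [e0x, hvx]; ring
    have h1 : pdr 1 v x = W x * pdr 1 u x := by simp only [ej 1 (by decide)]
    have h2 : pdr 2 v x = W x * pdr 2 u x := by simp only [ej 2 (by decide)]
    rw [hL, h0] at key
    have hsum : ∑ j, pdr j (carlemanFlux τ c v j) x = -12 * τ * ((x 0 + c) * pdr 0 v x * laplaceReal v x
        + pdr 0 v x * pdr 0 v x) - 8 * τ * (v x * laplaceReal v x + (pdr 0 v x * pdr 0 v x
        + pdr 1 v x * pdr 1 v x + pdr 2 v x * pdr 2 v x))
        + 6 * τ * (pdr 0 v x * pdr 0 v x + pdr 1 v x * pdr 1 v x + pdr 2 v x * pdr 2 v x)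
        - 6 * τ ^ 3 * (2 * (x 0 + c) ^ 3 * v x * pdr 0 v x + 3 * (x 0 + c) ^ 2 * (v x * v x)) := by
      simp only [Fin.sum_univ_three, pdr_carlemanFlux hvd, laplaceReal, pdr_comm hvd 1 0 x,
        pdr_comm hvd 2 0 x]
      simp
      ring
    rw [hsum, hWW, Fin.sum_univ_three]
    refine key.trans (le_of_eq ?_)
    rw [h1, h2, hvx]
    ring
  have hflux : ∀ j, Integrable (fun x => pdr j (carlemanFlux τ c v j) x) := fun j =>
    ((contDiff_carlemanFlux hvd j).continuous_pdr j one_ne_zero).integrable_of_hasCompactSupport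
      ((hasCompactSupport_carlemanFlux hvc j).pdr j)
  have hzero : ∫ x, ∑ j, pdr j (carlemanFlux τ c v j) x = 0 := by
    rw [integral_finsetSum _ fun j _ => hflux j]
    exact Finset.sum_eq_zero fun j _ =>
      integral_pdr_eq_zero (contDiff_carlemanFlux hvd j) (hasCompactSupport_carlemanFlux hvc j) j
  have hexp : Continuous fun x : R3 => Real.exp (τ * (x 0 + c) ^ 2) := by
    fun_prop
  have hpc : ∀ i, Continuous (pdr i u) := fun i => (hui i).continuous
  have hppc : ∀ i, Continuous (pdr i (pdr i u)) := fun i =>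
    (hu.pdr i (m := 1) (by norm_num)).continuous_pdr i one_ne_zero
  have i1 : Integrable fun x : R3 => Real.exp (τ * (x 0 + c) ^ 2) * laplaceReal u x ^ 2 := by
    apply Continuous.integrable_of_hasCompactSupport
    · exact hexp.mul ((continuous_finsetSum _ fun i _ => hppc i).pow 2)
    · simp only [sq]
      exact hc.laplaceReal.mul_left.mul_left
  have i2 : Integrable fun x : R3 => Real.exp (τ * (x 0 + c) ^ 2) * (u x ^ 2 + ∑ i, pdr i u x ^ 2) := by
    apply Continuous.integrable_of_hasCompactSupport
    · exact hexp.mul ((hu.continuous.pow 2).add (continuous_finsetSum _ fun i _ => (hpc i).pow 2))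
    · simp only [sq, Fin.sum_univ_three]
      exact (hc.mul_left.add (((hc.pdr 0).mul_left.add (hc.pdr 1).mul_left).add
        (hc.pdr 2).mul_left)).mul_left
  have := integral_mono (integrable_finsetSum _ fun j _ => hflux j) ((i1.const_mul 3).sub (i2.const_mul τ)) hpt
  rw [hzero] at this
  simp only [Pi.sub_apply] at this
  rw [integral_sub (i1.const_mul 3) (i2.const_mul τ), integral_const_mul, integral_const_mul] at this
  linarith

lemma pdr_re {u : R3 → ℂ} (hu : Differentiable ℝ u) (i : Fin 3) :
    pdr i (fun x => (u x).re) = fun x => (pd i u x).re := by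
  funext x
  have := (Complex.reCLM.hasFDerivAt.comp x (hu x).hasFDerivAt).fderiv
  rw [pdr, pd]
  erw [this]
  rfl

lemma pdr_im {u : R3 → ℂ} (hu : Differentiable ℝ u) (i : Fin 3) :
    pdr i (fun x => (u x).im) = fun x => (pd i u x).im := by
  funext x
  have := (Complex.imCLM.hasFDerivAt.comp x (hu x).hasFDerivAt).fderiv
  rw [pdr, pd]
  erw [this]
  rfl

lemma laplaceReal_re {u : R3 → ℂ} (hu : ContDiff ℝ 2 u) (x : R3) :
    laplaceReal (fun x => (u x).re) x = (laplace u x).re := by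
  have h1 : ∀ i, Differentiable ℝ (pd i u) := fun i =>
    (hu.pd i (m := 1) (by norm_num)).differentiable one_ne_zero
  simp only [laplaceReal, laplace, Complex.re_sum, pdr_re (hu.differentiable two_ne_zero), pdr_re (h1 _)]

lemma laplaceReal_im {u : R3 → ℂ} (hu : ContDiff ℝ 2 u) (x : R3) :
    laplaceReal (fun x => (u x).im) x = (laplace u x).im := by
  have h1 : ∀ i, Differentiable ℝ (pd i u) := fun i =>
    (hu.pd i (m := 1) (by norm_num)).differentiable one_ne_zero
  simp only [laplaceReal, laplace, Complex.im_sum, pdr_im (hu.differentiable two_ne_zero), pdr_im (h1 _)]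

lemma integrable_weight_energy {u : R3 → ℂ} (hc : HasCompactSupport u)
    (hu : ContDiff ℝ 1 u) (τ c : ℝ) :
    Integrable fun x : R3 => Real.exp (τ * (x 0 + c) ^ 2) * (‖u x‖ ^ 2 + ∑ i, ‖pd i u x‖ ^ 2) := by
  have hexp : Continuous fun x : R3 => Real.exp (τ * (x 0 + c) ^ 2) := by fun_prop
  apply Continuous.integrable_of_hasCompactSupport
  · exact hexp.mul ((hu.continuous.norm.pow 2).add
      (continuous_finsetSum _ fun i _ => (hu.continuous_pd i one_ne_zero).norm.pow 2))
  · simp only [sq, Fin.sum_univ_three]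
    exact (hc.norm.mul_left.add (((hc.pd 0).norm.mul_left.add (hc.pd 1).norm.mul_left).add
        (hc.pd 2).norm.mul_left)).mul_left

lemma integrable_weight_sq {f : R3 → ℂ} (hc : HasCompactSupport f)
    (hf : Continuous f) (τ c : ℝ) :
    Integrable fun x : R3 => Real.exp (τ * (x 0 + c) ^ 2) * ‖f x‖ ^ 2 := by
  have hexp : Continuous fun x : R3 => Real.exp (τ * (x 0 + c) ^ 2) := by fun_prop
  apply Continuous.integrable_of_hasCompactSupport
  · exact hexp.mul (hf.norm.pow 2)
  · simp only [sq]
    exact hc.norm.mul_left.mul_left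

/-- The Carleman estimate for complex-valued functions. -/
lemma carleman_estimate_complex {τ c : ℝ} (hτ : 1 ≤ τ) {u : R3 → ℂ} (hu : ContDiff ℝ 2 u)
    (hc : HasCompactSupport u) (hs : ∀ x, u x ≠ 0 → 1 ≤ x 0 + c) :
    τ * ∫ x, Real.exp (τ * (x 0 + c) ^ 2) * (‖u x‖ ^ 2 + ∑ i, ‖pd i u x‖ ^ 2) ≤
      3 * ∫ x, Real.exp (τ * (x 0 + c) ^ 2) * ‖laplace u x‖ ^ 2 := by
  have hr : ContDiff ℝ 2 fun x => (u x).re := Complex.reCLM.contDiff.comp hu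
  have hi : ContDiff ℝ 2 fun x => (u x).im := Complex.imCLM.contDiff.comp hu
  have hrc : HasCompactSupport fun x => (u x).re := hc.comp_left (g := Complex.re) rfl
  have hic : HasCompactSupport fun x => (u x).im := hc.comp_left (g := Complex.im) rfl
  have k1 := carleman_estimate hτ hr hrc (fun x hx => hs x fun h => hx (by simp [h]))
  have k2 := carleman_estimate hτ hi hic (fun x hx => hs x fun h => hx (by simp [h]))
  have hexp : Continuous fun x : R3 => Real.exp (τ * (x 0 + c) ^ 2) := by fun_prop
  have h1 : Differentiable ℝ u := hu.differentiable two_ne_zero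
  have hrl := hr.continuous_laplaceReal
  have hil := hi.continuous_laplaceReal
  have hen : ∀ {v : R3 → ℝ}, ContDiff ℝ 2 v → HasCompactSupport v → Integrable fun x : R3 =>
      Real.exp (τ * (x 0 + c) ^ 2) * (v x ^ 2 + ∑ i, pdr i v x ^ 2) := by
    intro v hv hvc
    apply Continuous.integrable_of_hasCompactSupport
    · exact hexp.mul ((hv.continuous.pow 2).add (continuous_finsetSum _ fun i _ =>
        (hv.continuous_pdr i two_ne_zero).pow 2))
    · simp only [sq, Fin.sum_univ_three]
      exact (hvc.mul_left.add (((hvc.pdr 0).mul_left.add (hvc.pdr 1).mul_left).add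
        (hvc.pdr 2).mul_left)).mul_left
  have hla : ∀ {v : R3 → ℝ}, ContDiff ℝ 2 v → HasCompactSupport v → Integrable fun x : R3 =>
      Real.exp (τ * (x 0 + c) ^ 2) * laplaceReal v x ^ 2 := by
    intro v hv hvc
    apply Continuous.integrable_of_hasCompactSupport
    · exact hexp.mul (hv.continuous_laplaceReal.pow 2)
    · simp only [sq]
      exact hvc.laplaceReal.mul_left.mul_left
  have e1 : ∫ x, Real.exp (τ * (x 0 + c) ^ 2) * (‖u x‖ ^ 2 + ∑ i, ‖pd i u x‖ ^ 2) =
      (∫ x, Real.exp (τ * (x 0 + c) ^ 2) * ((u x).re ^ 2 + ∑ i, pdr i (fun x => (u x).re) x ^ 2))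
      + ∫ x, Real.exp (τ * (x 0 + c) ^ 2) * ((u x).im ^ 2 + ∑ i, pdr i (fun x => (u x).im) x ^ 2) := by
    rw [← integral_add (hen hr hrc) (hen hi hic)]
    congr 1; funext x
    simp only [pdr_re h1, pdr_im h1, Complex.sq_norm, Complex.normSq_apply, Fin.sum_univ_three]
    ring
  have e2 : ∫ x, Real.exp (τ * (x 0 + c) ^ 2) * ‖laplace u x‖ ^ 2 =
      (∫ x, Real.exp (τ * (x 0 + c) ^ 2) * laplaceReal (fun x => (u x).re) x ^ 2)
      + ∫ x, Real.exp (τ * (x 0 + c) ^ 2) * laplaceReal (fun x => (u x).im) x ^ 2 := by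
    rw [← integral_add (hla hr hrc) (hla hi hic)]
    congr 1; funext x
    simp only [laplaceReal_re hu, laplaceReal_im hu, Complex.sq_norm, Complex.normSq_apply]
    ring
  rw [e1, e2]
  linarith

lemma HasCompactSupport.exists_one_le_add {f : R3 → ℂ} (hc : HasCompactSupport f) :
    ∃ c : ℝ, ∀ x, f x ≠ 0 → 1 ≤ x 0 + c := by
  obtain ⟨R, hR⟩ := hc.isCompact.isBounded.exists_norm_le
  refine ⟨R + 1, fun x hx => ?_⟩
  have h1 := hR x (subset_tsupport _ hx)
  have h2 := PiLp.norm_apply_le x 0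
  rw [Real.norm_eq_abs] at h2
  linarith [neg_abs_le (x 0)]

lemma eq_zero_of_integral_eq_zero {f : R3 → ℝ} (hf : Continuous f) (h0 : ∀ x, 0 ≤ f x)
    (hi : Integrable f) (h : ∫ x, f x = 0) (x : R3) : f x = 0 :=
  congrFun ((hf.ae_eq_iff_eq volume continuous_const).1
    ((integral_eq_zero_iff_of_nonneg h0 hi).1 h)) x

/-- Compactly supported solutions of a differential inequality for the Laplacian vanish. -/
lemma eq_zero_of_laplace_le {u : Fin 3 → R3 → ℂ} (hu : ∀ a, ContDiff ℝ 2 (u a))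
    (hc : ∀ a, HasCompactSupport (u a)) {C : ℝ}
    (h : ∀ x, ∑ a, ‖laplace (u a) x‖ ^ 2 ≤ C * ∑ a, (‖u a x‖ ^ 2 + ∑ i, ‖pd i (u a) x‖ ^ 2))
    (a : Fin 3) (x : R3) : u a x = 0 := by
  choose c' hc' using fun a => (hc a).exists_one_le_add
  set c : ℝ := ∑ b, |c' b| with hcdef
  have hcc : ∀ b, c' b ≤ c := fun b => (le_abs_self _).trans
    (Finset.single_le_sum (f := fun b => |c' b|) (fun _ _ => abs_nonneg _) (Finset.mem_univ b))
  set τ : ℝ := 3 * |C| + 1 with hτ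
  have hτ1 : 1 ≤ τ := by rw [hτ]; linarith [abs_nonneg C]
  set J : Fin 3 → ℝ := fun b =>
    ∫ x, Real.exp (τ * (x 0 + c) ^ 2) * (‖u b x‖ ^ 2 + ∑ i, ‖pd i (u b) x‖ ^ 2) with hJ
  have hint : ∀ b, Integrable fun x : R3 => Real.exp (τ * (x 0 + c) ^ 2) *
      (‖u b x‖ ^ 2 + ∑ i, ‖pd i (u b) x‖ ^ 2) := fun b =>
    integrable_weight_energy (hc b) ((hu b).of_le one_le_two) τ c
  have hintl : ∀ b, Integrable fun x : R3 => Real.exp (τ * (x 0 + c) ^ 2) * ‖laplace (u b) x‖ ^ 2 :=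
    fun b => integrable_weight_sq (hc b).laplace (hu b).continuous_laplace τ c
  have hJ0 : ∀ b, 0 ≤ J b := fun b => integral_nonneg fun x => by positivity
  have hcar : ∀ b, τ * J b ≤ 3 * ∫ x, Real.exp (τ * (x 0 + c) ^ 2) * ‖laplace (u b) x‖ ^ 2 :=
    fun b => carleman_estimate_complex hτ1 (hu b) (hc b) fun x hx =>
      (hc' b x hx).trans (by linarith [hcc b])
  have hsum : ∑ b, ∫ x, Real.exp (τ * (x 0 + c) ^ 2) * ‖laplace (u b) x‖ ^ 2 ≤ |C| * ∑ b, J b := by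
    rw [← integral_finsetSum _ fun b _ => hintl b, hJ]
    simp only
    rw [← integral_finsetSum _ fun b _ => hint b, ← integral_const_mul]
    refine integral_mono (integrable_finsetSum _ fun b _ => hintl b)
      ((integrable_finsetSum _ fun b _ => hint b).const_mul _) fun x => ?_
    simp only
    rw [← Finset.mul_sum, ← Finset.mul_sum, mul_left_comm]
    refine mul_le_mul_of_nonneg_left ((h x).trans ?_) (Real.exp_pos _).le
    exact mul_le_mul_of_nonneg_right (le_abs_self C) (by positivity)
  have htot : τ * ∑ b, J b ≤ 3 * (|C| * ∑ b, J b) := by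
    rw [Finset.mul_sum]
    refine (Finset.sum_le_sum fun b _ => hcar b).trans ?_
    rw [← Finset.mul_sum]
    linarith
  have hz : ∑ b, J b ≤ 0 := by rw [hτ] at htot; linarith
  have hJa : J a = 0 :=
    (Finset.sum_eq_zero_iff_of_nonneg fun b _ => hJ0 b).1
      (le_antisymm hz (Finset.sum_nonneg fun b _ => hJ0 b)) a (Finset.mem_univ a)
  have hcont : Continuous fun x : R3 => Real.exp (τ * (x 0 + c) ^ 2) *
      (‖u a x‖ ^ 2 + ∑ i, ‖pd i (u a) x‖ ^ 2) := by
    have hexp : Continuous fun x : R3 => Real.exp (τ * (x 0 + c) ^ 2) := by fun_prop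
    exact hexp.mul (((hu a).continuous.norm.pow 2).add
      (continuous_finsetSum _ fun i _ => ((hu a).continuous_pd i two_ne_zero).norm.pow 2))
  have := eq_zero_of_integral_eq_zero hcont (fun x => by positivity) (hint a) hJa x
  simp only [mul_eq_zero, (Real.exp_pos _).ne', false_or] at this
  have h1 : 0 ≤ ∑ i, ‖pd i (u a) x‖ ^ 2 := by positivity
  have h2 : ‖u a x‖ ^ 2 = 0 := le_antisymm (by linarith) (by positivity)
  simpa using h2

/-! ### The fundamental solution -/

/-- The regularised distance to the origin. -/
def smoothNorm (ε : ℝ) (x : R3) : ℝ := √(‖x‖ ^ 2 + ε ^ 2)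

lemma smoothNorm_pos {ε : ℝ} (hε : 0 < ε) (x : R3) : 0 < smoothNorm ε x :=
  Real.sqrt_pos.2 (by positivity)

lemma smoothNorm_sq (ε : ℝ) (x : R3) : smoothNorm ε x ^ 2 = ‖x‖ ^ 2 + ε ^ 2 :=
  Real.sq_sqrt (by positivity)

lemma norm_le_smoothNorm (ε : ℝ) (x : R3) : ‖x‖ ≤ smoothNorm ε x :=
  Real.le_sqrt_of_sq_le (by nlinarith [sq_nonneg ε])

lemma contDiff_smoothNorm {ε : ℝ} (hε : 0 < ε) {n : WithTop ℕ∞} : ContDiff ℝ n (smoothNorm ε) :=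
  ((contDiff_norm_sq ℝ).add contDiff_const).sqrt fun x => by positivity

lemma hasFDerivAt_smoothNorm {ε : ℝ} (hε : 0 < ε) (x : R3) :
    HasFDerivAt (smoothNorm ε) ((smoothNorm ε x)⁻¹ • (innerSL ℝ x)) x := by
  have h := ((hasStrictFDerivAt_norm_sq x).hasFDerivAt.add_const (ε ^ 2)).sqrt
    (by positivity)
  refine h.congr_fderiv ?_
  ext v
  simp only [smoothNorm, smul_apply, smul_eq_mul]
  field_simp
  simp

lemma pd_comp_smoothNorm {ε : ℝ} (hε : 0 < ε) {F : ℝ → ℂ} {F' : ℂ} {x : R3}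
    (hF : HasDerivAt F F' (smoothNorm ε x)) (j : Fin 3) :
    pd j (fun y => F (smoothNorm ε y)) x = F' * (x j / smoothNorm ε x : ℝ) := by
  have h := hF.hasFDerivAt.comp x (hasFDerivAt_smoothNorm hε x)
  rw [pd]
  erw [h.fderiv]
  simp [EuclideanSpace.inner_single_right, div_eq_inv_mul]
  ring

/-- The regularised fundamental solution. -/
def smoothKernel (k ε : ℝ) (x : R3) : ℂ :=
  Complex.exp (Complex.I * k * (smoothNorm ε x : ℝ)) / (4 * Real.pi * (smoothNorm ε x : ℝ))

lemma contDiff_smoothKernel (k : ℝ) {ε : ℝ} (hε : 0 < ε) {n : WithTop ℕ∞} :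
    ContDiff ℝ n (smoothKernel k ε) := by
  have h : ContDiff ℝ n fun x : R3 => ((smoothNorm ε x : ℝ) : ℂ) :=
    Complex.ofRealCLM.contDiff.comp (contDiff_smoothNorm hε)
  unfold smoothKernel
  simp only [div_eq_mul_inv]
  refine ((contDiff_const.mul h).cexp).mul ((contDiff_const.mul h).inv fun x => ?_)
  have := (smoothNorm_pos hε x).ne'
  simp [this, Real.pi_ne_zero]

lemma norm_smoothKernel (k : ℝ) {ε : ℝ} (hε : 0 < ε) (x : R3) :
    ‖smoothKernel k ε x‖ = 1 / (4 * Real.pi * smoothNorm ε x) := by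
  have hs := smoothNorm_pos hε x
  have h : (4 * (Real.pi : ℂ) * (smoothNorm ε x : ℝ)) = ((4 * Real.pi * smoothNorm ε x : ℝ) : ℂ) := by
    push_cast; ring
  rw [smoothKernel, norm_div, norm_exp_I_mul_ofReal_mul, h, Complex.norm_of_nonneg]
  positivity

lemma hasDerivAt_exp_div_pow (k : ℝ) (n : ℕ) {s : ℝ} (hs : s ≠ 0) :
    HasDerivAt (fun s : ℝ => Complex.exp (Complex.I * k * s) / (s : ℂ) ^ n)
      (Complex.exp (Complex.I * k * s) * (Complex.I * k / (s : ℂ) ^ n - n / (s : ℂ) ^ (n + 1))) s := by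
  have hs' : (s : ℂ) ≠ 0 := by exact_mod_cast hs
  have h0 : HasDerivAt (fun s : ℝ => (s : ℂ)) 1 s := Complex.ofRealCLM.hasDerivAt
  have h1 := (h0.const_mul (Complex.I * k)).cexp
  have h2 := h1.div (h0.pow n) (pow_ne_zero n hs')
  convert! h2 using 1
  rcases n with _ | n
  · simp
  · simp only [Nat.add_sub_cancel, Pi.pow_apply]
    field_simp
    ring

lemma laplace_smoothKernel (k : ℝ) {ε : ℝ} (hε : 0 < ε) (x : R3) :
    laplace (smoothKernel k ε) x + (k : ℂ) ^ 2 * smoothKernel k ε x =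
      (ε : ℂ) ^ 2 / (4 * Real.pi) * Complex.exp (Complex.I * k * (smoothNorm ε x : ℝ)) *
        (k ^ 2 / (smoothNorm ε x : ℂ) ^ 3 + 3 * Complex.I * k / (smoothNorm ε x : ℂ) ^ 4
          - 3 / (smoothNorm ε x : ℂ) ^ 5) := by
  have hsp := smoothNorm_pos hε
  have e : ∀ n : ℕ, ∀ x j, pd j (fun y => Complex.exp (Complex.I * k * (smoothNorm ε y : ℝ))
      / (smoothNorm ε y : ℂ) ^ n) x = Complex.exp (Complex.I * k * (smoothNorm ε x : ℝ)) *
      (Complex.I * k / (smoothNorm ε x : ℂ) ^ n - n / (smoothNorm ε x : ℂ) ^ (n + 1))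
        * (x j / smoothNorm ε x : ℝ) := fun n x j =>
    pd_comp_smoothNorm hε (F := fun s : ℝ => Complex.exp (Complex.I * k * s) / (s : ℂ) ^ n)
      (hasDerivAt_exp_div_pow k n (hsp x).ne') j
  have hd : ∀ n : ℕ, Differentiable ℝ (fun y => Complex.exp (Complex.I * k * (smoothNorm ε y : ℝ))
      / (smoothNorm ε y : ℂ) ^ n) := by
    intro n
    have h : ContDiff ℝ 1 fun x : R3 => ((smoothNorm ε x : ℝ) : ℂ) :=
      Complex.ofRealCLM.contDiff.comp (contDiff_smoothNorm hε)
    simp only [div_eq_mul_inv]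
    refine ContDiff.differentiable (n := 1) (((contDiff_const.mul h).cexp).mul ((h.pow n).inv
      fun x => ?_)) one_ne_zero
    have := (hsp x).ne'
    simp [this]
  have e1 : ∀ j, pd j (smoothKernel k ε) = fun x => (1 / (4 * Real.pi) : ℂ) *
      ((x j : ℂ) * (Complex.I * k * (Complex.exp (Complex.I * k * (smoothNorm ε x : ℝ))
        / (smoothNorm ε x : ℂ) ^ 2) + (-1) * (Complex.exp (Complex.I * k * (smoothNorm ε x : ℝ))
        / (smoothNorm ε x : ℂ) ^ 3))) := by
    intro j
    funext x
    have h : smoothKernel k ε = fun y => (1 / (4 * Real.pi) : ℂ) *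
        (Complex.exp (Complex.I * k * (smoothNorm ε y : ℝ)) / (smoothNorm ε y : ℂ) ^ 1) := by
      funext y; simp only [smoothKernel]; field_simp
    rw [h, pd_const_mul (hd 1 x), e]
    have : (smoothNorm ε x : ℂ) ≠ 0 := by exact_mod_cast (hsp x).ne'
    push_cast
    field_simp
    ring
  have hx : ∀ j : Fin 3, ∀ x, HasFDerivAt (fun y : R3 => ((y j : ℝ) : ℂ))
      (Complex.ofRealCLM.comp (EuclideanSpace.proj (𝕜 := ℝ) j)) x := fun j x =>
    (Complex.ofRealCLM.comp (EuclideanSpace.proj (𝕜 := ℝ) j)).hasFDerivAt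
  have hxx : ∀ j : Fin 3, ∀ x, pd j (fun y : R3 => ((y j : ℝ) : ℂ)) x = 1 := by
    intro j x
    rw [pd, (hx j x).fderiv]
    simp
  have e2 : ∀ j, pd j (pd j (smoothKernel k ε)) x = (1 / (4 * Real.pi) : ℂ) *
      Complex.exp (Complex.I * k * (smoothNorm ε x : ℝ)) *
      ((Complex.I * k / (smoothNorm ε x : ℂ) ^ 2 - 1 / (smoothNorm ε x : ℂ) ^ 3) + (x j : ℂ) ^ 2 *
        (- k ^ 2 / (smoothNorm ε x : ℂ) ^ 3 - 3 * Complex.I * k / (smoothNorm ε x : ℂ) ^ 4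
          + 3 / (smoothNorm ε x : ℂ) ^ 5)) := by
    intro j
    have dA := ((hd 2).const_mul (Complex.I * k)).fun_add ((hd 3).const_mul (-1))
    rw [e1, pd_const_mul, pd_mul (hx j x).differentiableAt (dA x),
      pd_add (((hd 2).const_mul (Complex.I * k)) x) (((hd 3).const_mul (-1)) x),
      pd_const_mul (hd 2 x), pd_const_mul (hd 3 x), e, e, hxx]
    · have : (smoothNorm ε x : ℂ) ≠ 0 := by exact_mod_cast (hsp x).ne'
      push_cast
      field_simp
      ring_nf
      simp only [Complex.I_sq]
      ring
    · exact (hx j x).differentiableAt.fun_mul (dA x)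
  have hsq : (x 0 : ℂ) ^ 2 + (x 1 : ℂ) ^ 2 + (x 2 : ℂ) ^ 2 = (smoothNorm ε x : ℂ) ^ 2 - (ε : ℂ) ^ 2 := by
    have h1 := smoothNorm_sq ε x
    have h2 := EuclideanSpace.real_norm_sq_eq x
    rw [Fin.sum_univ_three] at h2
    rw [eq_sub_iff_add_eq]
    exact_mod_cast (by rw [h1, h2] : x 0 ^ 2 + x 1 ^ 2 + x 2 ^ 2 + ε ^ 2 = smoothNorm ε x ^ 2)
  have : (smoothNorm ε x : ℂ) ≠ 0 := by exact_mod_cast (hsp x).ne'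
  rw [laplace, Fin.sum_univ_three, e2, e2, e2, smoothKernel]
  have hx2 : (x 2 : ℂ) ^ 2 = (smoothNorm ε x : ℂ) ^ 2 - (ε : ℂ) ^ 2 - (x 0 : ℂ) ^ 2 - (x 1 : ℂ) ^ 2 := by
    rw [← hsq]; ring
  rw [hx2]
  field_simp
  ring

lemma smoothNorm_smul {ε : ℝ} (hε : 0 < ε) (z : R3) :
    smoothNorm ε (ε • z) = ε * smoothNorm 1 z := by
  rw [smoothNorm, smoothNorm, norm_smul, Real.norm_of_nonneg hε.le,
    show (ε * ‖z‖) ^ 2 + ε ^ 2 = ε ^ 2 * (‖z‖ ^ 2 + 1 ^ 2) by ring, Real.sqrt_mul (by positivity),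
    Real.sqrt_sq hε.le]

lemma continuous_smoothNorm (ε : ℝ) : Continuous (smoothNorm ε) := by
  unfold smoothNorm; fun_prop

lemma one_le_smoothNorm_one (z : R3) : 1 ≤ smoothNorm 1 z :=
  Real.le_sqrt_of_sq_le (by nlinarith [sq_nonneg ‖z‖])

lemma integrable_smoothNorm_inv_pow {n : ℕ} (hn : 3 < n) :
    Integrable fun z : R3 => (smoothNorm 1 z ^ n)⁻¹ := by
  have h := integrable_rpow_neg_one_add_norm_sq (E := R3) (μ := volume) (r := n) (by
    simpa using hn)
  refine h.congr (Filter.Eventually.of_forall fun z => ?_)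
  have h1 : (0 : ℝ) ≤ 1 + ‖z‖ ^ 2 := by positivity
  simp only [smoothNorm]
  rw [neg_div, Real.rpow_neg h1, ← Real.rpow_natCast (√(‖z‖ ^ 2 + 1 ^ 2)), Real.sqrt_eq_rpow,
    ← Real.rpow_mul (by positivity)]
  congr 2
  · ring
  · ring

lemma integral_smoothNorm_inv_pow_five :
    ∫ z : R3, (smoothNorm 1 z ^ 5)⁻¹ = 4 * Real.pi / 3 := by
  have h := integral_fun_norm_addHaar (E := R3) volume (fun r => (√(r ^ 2 + 1 ^ 2) ^ 5)⁻¹)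
  have hd : Module.finrank ℝ R3 = 3 := by simp
  have hv : volume.real (Metric.ball (0 : R3) 1) = Real.pi * 4 / 3 := by
    rw [Measure.real, EuclideanSpace.volume_ball_fin_three]
    rw [ENNReal.toReal_mul]
    simp
    positivity
  have hone : ∫ r in Set.Ioi (0 : ℝ), r ^ 2 • (√(r ^ 2 + 1 ^ 2) ^ 5)⁻¹ = 1 / 3 := by
    have hder : ∀ r ∈ Set.Ici (0 : ℝ), HasDerivAt (fun r => (r / √(r ^ 2 + 1)) ^ 3 / 3)
        (r ^ 2 • (√(r ^ 2 + 1 ^ 2) ^ 5)⁻¹) r := by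
      intro r _
      have hp : (0 : ℝ) < r ^ 2 + 1 := by positivity
      have hs : HasDerivAt (fun r : ℝ => √(r ^ 2 + 1)) (2 * r / (2 * √(r ^ 2 + 1))) r := by
        have := ((hasDerivAt_pow 2 r).add_const 1).sqrt hp.ne'
        simpa using this
      have hsp : 0 < √(r ^ 2 + 1) := Real.sqrt_pos.2 hp
      have h2 := (((hasDerivAt_id r).div hs hsp.ne').pow 3).div_const 3
      convert! h2 using 1
      have hq : √(r ^ 2 + 1) ^ 2 = r ^ 2 + 1 := Real.sq_sqrt hp.le
      simp only [smul_eq_mul, one_pow, id, Pi.div_apply]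
      set s := √(r ^ 2 + 1)
      have e : 1 * s - r * (2 * r / (2 * s)) = s⁻¹ := by
        field_simp
        linarith
      rw [e]
      push_cast
      field_simp
    have hlim : Filter.Tendsto (fun r : ℝ => (r / √(r ^ 2 + 1)) ^ 3 / 3) Filter.atTop (𝓝 (1 / 3)) := by
      have h1 : Filter.Tendsto (fun r : ℝ => √(1 + (r⁻¹) ^ 2)) Filter.atTop (𝓝 1) := by
        have : Filter.Tendsto (fun r : ℝ => √(1 + (r⁻¹) ^ 2)) Filter.atTop (𝓝 √(1 + 0 ^ 2)) :=
          ((tendsto_inv_atTop_zero.pow 2).const_add 1).sqrt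
        simpa using this
      have h2 : Filter.Tendsto (fun r : ℝ => ((√(1 + (r⁻¹) ^ 2))⁻¹) ^ 3 / 3) Filter.atTop
          (𝓝 ((1 : ℝ)⁻¹ ^ 3 / 3)) := ((h1.inv₀ one_ne_zero).pow 3).div_const 3
      have h3 : ((1 : ℝ)⁻¹ ^ 3 / 3) = 1 / 3 := by norm_num
      rw [h3] at h2
      refine h2.congr' ?_
      filter_upwards [Filter.eventually_gt_atTop 0] with r hr
      congr 2
      have : √(r ^ 2 + 1) = r * √(1 + (r⁻¹) ^ 2) := by
        rw [show r ^ 2 + 1 = r ^ 2 * (1 + (r⁻¹) ^ 2) by field_simp, Real.sqrt_mul (by positivity),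
          Real.sqrt_sq hr.le]
      rw [this, div_mul_eq_div_div, div_self hr.ne', one_div]
    have := integral_Ioi_of_hasDerivAt_of_nonneg' hder (fun r hr => by
      have : (0:ℝ) < r := hr
      positivity) hlim
    rw [this]; simp
  rw [hd, hv] at h
  simp only [show 3 - 1 = 2 from rfl] at h
  rw [hone] at h
  have e : (fun z : R3 => (smoothNorm 1 z ^ 5)⁻¹) = fun z => (√(‖z‖ ^ 2 + 1 ^ 2) ^ 5)⁻¹ := rfl
  rw [e, h]
  simp
  ring

lemma integral_smoothKernel_mul {k ε : ℝ} (hε : 0 < ε) {φ : R3 → ℂ} (hφ : ContDiff ℝ 2 φ)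
    (hc : HasCompactSupport φ) :
    ∫ x, smoothKernel k ε x * (laplace φ x + (k : ℂ) ^ 2 * φ x) =
      ∫ z, (1 / (4 * Real.pi) : ℂ) * (Complex.exp (Complex.I * k * (ε * smoothNorm 1 z : ℝ)) *
        (k ^ 2 * ε ^ 2 / (smoothNorm 1 z : ℂ) ^ 3 + 3 * Complex.I * k * ε / (smoothNorm 1 z : ℂ) ^ 4
          - 3 / (smoothNorm 1 z : ℂ) ^ 5) * φ (ε • z)) := by
  have hK : ContDiff ℝ 2 (smoothKernel k ε) := contDiff_smoothKernel k hε
  have i1 : Integrable fun x => smoothKernel k ε x * laplace φ x :=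
    (hK.continuous.mul hφ.continuous_laplace).integrable_of_hasCompactSupport hc.laplace.mul_left
  have i2 : Integrable fun x => smoothKernel k ε x * ((k : ℂ) ^ 2 * φ x) :=
    (hK.continuous.mul (continuous_const.mul hφ.continuous)).integrable_of_hasCompactSupport
      hc.mul_left.mul_left
  have i3 : Integrable fun x => laplace (smoothKernel k ε) x * φ x :=
    (hK.continuous_laplace.mul hφ.continuous).integrable_of_hasCompactSupport hc.mul_left
  have e1 : ∫ x, smoothKernel k ε x * (laplace φ x + (k : ℂ) ^ 2 * φ x) =
      ∫ x, (laplace (smoothKernel k ε) x + (k : ℂ) ^ 2 * smoothKernel k ε x) * φ x := by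
    simp only [mul_add]
    rw [integral_add i1 i2, integral_mul_laplace hK hφ hc, ← integral_add i3 i2]
    congr 1; funext x; ring
  rw [e1]
  set F : R3 → ℂ := fun x =>
    (laplace (smoothKernel k ε) x + (k : ℂ) ^ 2 * smoothKernel k ε x) * φ x with hF
  have h := Measure.integral_comp_smul (volume : Measure R3) F ε
  have hd : Module.finrank ℝ R3 = 3 := by simp
  rw [hd, abs_of_pos (by positivity)] at h
  have h' : ∫ x, F x = ∫ z, (ε : ℂ) ^ 3 * F (ε • z) := by
    rw [integral_const_mul, h, Complex.real_smul]
    have : (ε : ℂ) ≠ 0 := by exact_mod_cast hε.ne'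
    push_cast
    field_simp
  rw [h']
  congr 1; funext z
  have h1 : (smoothNorm 1 z : ℂ) ≠ 0 := by exact_mod_cast (smoothNorm_pos one_pos z).ne'
  have h2 : (ε : ℂ) ≠ 0 := by exact_mod_cast hε.ne'
  rw [hF]
  simp only
  rw [laplace_smoothKernel k hε, smoothNorm_smul hε]
  push_cast
  field_simp

/-- The Helmholtz kernel is a fundamental solution. -/
lemma integral_helmholtzKernel_mul {k : ℝ} {φ : R3 → ℂ} (hφ : ContDiff ℝ 2 φ)
    (hc : HasCompactSupport φ) :
    ∫ x, helmholtzKernel k x * (laplace φ x + (k : ℂ) ^ 2 * φ x) = -φ 0 := by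
  set ε : ℕ → ℝ := fun n => 1 / ((n : ℝ) + 1) with hε
  have hε0 : ∀ n, 0 < ε n := fun n => by positivity
  have hε1 : ∀ n, ε n ≤ 1 := fun n => by
    rw [hε]; simp only; rw [div_le_one (by positivity)]; linarith [(Nat.cast_nonneg n : (0:ℝ) ≤ n)]
  have hεl : Filter.Tendsto ε Filter.atTop (𝓝 0) := tendsto_one_div_add_atTop_nhds_zero_nat
  set f : R3 → ℂ := fun x => laplace φ x + (k : ℂ) ^ 2 * φ x with hf
  have hfc : Continuous f := hφ.continuous_laplace.add (continuous_const.mul hφ.continuous)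
  have hfs : HasCompactSupport f := hc.laplace.add hc.mul_left
  have lim1 : Filter.Tendsto (fun n => ∫ x, smoothKernel k (ε n) x * f x) Filter.atTop
      (𝓝 (∫ x, helmholtzKernel k x * f x)) := by
    refine tendsto_integral_of_dominated_convergence (fun x => ‖helmholtzKernel k x * f x‖)
      (fun n => ((contDiff_smoothKernel k (hε0 n) (n := 0)).continuous.mul hfc).aestronglyMeasurable)
      (hfs.integrable_helmholtzKernel_mul hfc).norm ?_ ?_
    · intro n
      filter_upwards [Measure.ae_ne volume (0 : R3)] with x hx
      have : 0 < ‖x‖ := norm_pos_iff.2 hx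
      rw [norm_mul, norm_mul, norm_smoothKernel k (hε0 n), norm_helmholtzKernel]
      have := norm_le_smoothNorm (ε n) x
      gcongr
    · filter_upwards [Measure.ae_ne volume (0 : R3)] with x hx
      have hx' : ‖x‖ ≠ 0 := (norm_pos_iff.2 hx).ne'
      have h0 : Filter.Tendsto (fun n => ((smoothNorm (ε n) x : ℝ) : ℂ)) Filter.atTop
          (𝓝 ((‖x‖ : ℝ) : ℂ)) := by
        have h1 : Filter.Tendsto (fun n => smoothNorm (ε n) x) Filter.atTop
            (𝓝 (√(‖x‖ ^ 2 + 0 ^ 2))) := ((hεl.pow 2).const_add _).sqrt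
        rw [zero_pow two_ne_zero, add_zero, Real.sqrt_sq (norm_nonneg x)] at h1
        exact (Complex.continuous_ofReal.tendsto _).comp h1
      refine Filter.Tendsto.mul_const _ ?_
      refine Filter.Tendsto.div ?_ (h0.const_mul _) ?_
      · exact (Complex.continuous_exp.tendsto _).comp (h0.const_mul _)
      · simp [hx, Real.pi_ne_zero]
  obtain ⟨M, hM⟩ := hφ.continuous.bounded_above_of_compact_support hc
  obtain ⟨R, hR⟩ := hc.isCompact.isBounded.exists_norm_le
  have hM0 : 0 ≤ M := (norm_nonneg _).trans (hM 0)
  set B : ℝ := (k ^ 2 * (1 + |R|) + 3 * |k| + 3) * M with hB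
  have lim2 : Filter.Tendsto (fun n => ∫ x, smoothKernel k (ε n) x * f x) Filter.atTop
      (𝓝 (∫ z, (1 / (4 * Real.pi) : ℂ) * (-3 * ((smoothNorm 1 z ^ 5)⁻¹ : ℝ) * φ 0))) := by
    simp only [hf, integral_smoothKernel_mul (hε0 _) hφ hc]
    have hσc : Continuous fun z : R3 => ((smoothNorm 1 z : ℝ) : ℂ) :=
      Complex.continuous_ofReal.comp (continuous_smoothNorm 1)
    have hσ0 : ∀ z : R3, ((smoothNorm 1 z : ℝ) : ℂ) ≠ 0 := fun z => by
      exact_mod_cast (smoothNorm_pos one_pos z).ne'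
    refine tendsto_integral_of_dominated_convergence
      (fun z => 1 / (4 * Real.pi) * (B * (smoothNorm 1 z ^ 4)⁻¹)) ?_ ?_ ?_ ?_
    · intro n
      refine Continuous.aestronglyMeasurable ?_
      have h3 : Continuous fun z : R3 => φ (ε n • z) := hφ.continuous.comp (continuous_const_smul _)
      have h4 : Continuous fun z : R3 => ((ε n * smoothNorm 1 z : ℝ) : ℂ) :=
        Complex.continuous_ofReal.comp (continuous_const.mul (continuous_smoothNorm 1))
      have d : ∀ (m : ℕ) (c : ℂ), Continuous fun z : R3 => c / ((smoothNorm 1 z : ℝ) : ℂ) ^ m :=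
        fun m c => continuous_const.div (hσc.pow m) fun z => pow_ne_zero m (hσ0 z)
      exact continuous_const.mul (((continuous_const.mul h4).cexp.mul (((d 3 _).add (d 4 _)).sub
        (d 5 _))).mul h3)
    · exact ((integrable_smoothNorm_inv_pow (by norm_num)).const_mul _).const_mul _
    · intro n
      refine Filter.Eventually.of_forall fun z => ?_
      have hs1 := one_le_smoothNorm_one z
      set σ := smoothNorm 1 z with hσ
      have hσp : 0 < σ := by linarith
      have hε' := hε0 n
      rw [norm_mul, norm_mul, norm_mul, norm_exp_I_mul_ofReal_mul, one_mul]
      have n0 : ‖(1 / (4 * Real.pi) : ℂ)‖ = 1 / (4 * Real.pi) := by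
        rw [norm_div, norm_mul, Complex.norm_of_nonneg Real.pi_pos.le]; simp
      rw [n0]
      refine mul_le_mul_of_nonneg_left ?_ (by positivity)
      by_cases hz : φ (ε n • z) = 0
      · rw [hz, norm_zero, mul_zero]; positivity
      have hz1 : ε n * σ ≤ 1 + |R| := by
        have h1 := hR _ (subset_tsupport _ hz)
        rw [norm_smul, Real.norm_of_nonneg hε'.le] at h1
        have h2 : σ ≤ ‖z‖ + 1 := by
          rw [hσ, smoothNorm]
          exact Real.sqrt_le_iff.2 ⟨by positivity, by nlinarith [norm_nonneg z]⟩
        nlinarith [hε1 n, le_abs_self R, norm_nonneg z]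
      have h3 : ‖(k ^ 2 * (ε n : ℂ) ^ 2 / (σ : ℂ) ^ 3 + 3 * Complex.I * k * ε n / (σ : ℂ) ^ 4
          - 3 / (σ : ℂ) ^ 5)‖ ≤ (k ^ 2 * (1 + |R|) + 3 * |k| + 3) * (σ ^ 4)⁻¹ := by
        refine (norm_sub_le _ _).trans ?_
        have q1 : ‖(k ^ 2 * (ε n : ℂ) ^ 2 / (σ : ℂ) ^ 3 : ℂ)‖ ≤ k ^ 2 * (1 + |R|) * (σ ^ 4)⁻¹ := by
          simp only [norm_div, norm_mul, norm_pow, Complex.norm_real, Real.norm_eq_abs, sq_abs]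
          rw [abs_of_pos hσp, ← div_eq_mul_inv, div_le_div_iff₀ (by positivity) (by positivity)]
          have : ε n ^ 2 * σ ≤ 1 + |R| := by nlinarith [hε1 n, abs_nonneg R]
          nlinarith [mul_le_mul_of_nonneg_left this (by positivity : 0 ≤ k ^ 2 * σ ^ 3)]
        have q2 : ‖(3 * Complex.I * k * ε n / (σ : ℂ) ^ 4 : ℂ)‖ ≤ 3 * |k| * (σ ^ 4)⁻¹ := by
          simp only [norm_div, norm_mul, norm_pow, Complex.norm_real, Real.norm_eq_abs, Complex.norm_I]
          rw [abs_of_pos hσp, abs_of_pos hε', ← div_eq_mul_inv]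
          norm_num
          refine div_le_div_of_nonneg_right ?_ (by positivity)
          nlinarith [hε1 n, abs_nonneg k]
        have q3 : ‖(3 / (σ : ℂ) ^ 5 : ℂ)‖ ≤ 3 * (σ ^ 4)⁻¹ := by
          simp only [norm_div, norm_pow, Complex.norm_real, Real.norm_eq_abs]
          rw [abs_of_pos hσp, ← div_eq_mul_inv]
          norm_num
          gcongr
          norm_num
        refine (add_le_add ((norm_add_le _ _).trans (add_le_add q1 q2)) q3).trans (le_of_eq ?_)
        ring
      calc _ ≤ ((k ^ 2 * (1 + |R|) + 3 * |k| + 3) * (σ ^ 4)⁻¹) * M :=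
            mul_le_mul h3 (hM _) (norm_nonneg _) (by positivity)
        _ = _ := by rw [hB]; ring
    · refine Filter.Eventually.of_forall fun z => ?_
      have hεc : Filter.Tendsto (fun n => (ε n : ℂ)) Filter.atTop (𝓝 ((0 : ℝ) : ℂ)) :=
        (Complex.continuous_ofReal.tendsto _).comp hεl
      have hφl : Filter.Tendsto (fun n => φ (ε n • z)) Filter.atTop (𝓝 (φ ((0 : ℝ) • z))) :=
        (hφ.continuous.tendsto _).comp (hεl.smul_const z)
      have hel : Filter.Tendsto (fun n => Complex.exp (Complex.I * k * (ε n * smoothNorm 1 z : ℝ)))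
          Filter.atTop (𝓝 (Complex.exp (Complex.I * k * (0 * smoothNorm 1 z : ℝ)))) :=
        (Complex.continuous_exp.tendsto _).comp
          (((Complex.continuous_ofReal.tendsto _).comp (hεl.mul_const _)).const_mul _)
      have := ((hel.mul (((((hεc.pow 2).const_mul ((k : ℂ) ^ 2)).div_const
        ((smoothNorm 1 z : ℂ) ^ 3)).add ((hεc.const_mul (3 * Complex.I * k)).div_const
        ((smoothNorm 1 z : ℂ) ^ 4))).sub_const (3 / (smoothNorm 1 z : ℂ) ^ 5))).mul hφl).const_mul
        (1 / (4 * Real.pi) : ℂ)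
      convert! this using 2
      simp
      field_simp
      simp
  rw [tendsto_nhds_unique lim1 lim2]
  simp only [integral_const_mul, integral_mul_const, integral_complex_ofReal,
    integral_smoothNorm_inv_pow_five]
  have : (Real.pi : ℂ) ≠ 0 := by exact_mod_cast Real.pi_ne_zero
  push_cast
  field_simp

/-! ### Weak and strong forms of the Helmholtz equation -/

lemma g_comm (k : ℝ) (x y : R3) : g k x y = g k y x := by
  rw [g, g, norm_sub_rev]

lemma integrable_mul_g_mul {k : ℝ} {a b : R3 → ℂ} (ha : Continuous a) (ha' : HasCompactSupport a)
    (hb : Continuous b) (hb' : HasCompactSupport b) :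
    Integrable (fun p : R3 × R3 => a p.1 * g k p.1 p.2 * b p.2) (volume.prod volume) := by
  obtain ⟨R, hR⟩ := ha'.isCompact.isBounded.exists_norm_le
  obtain ⟨S, hS⟩ := hb'.isCompact.isBounded.exists_norm_le
  obtain ⟨M, hM⟩ := ha.bounded_above_of_compact_support ha'
  set K : R3 → ℂ := (Metric.ball (0 : R3) (R + S + 1)).indicator (helmholtzKernel k) with hK
  have hKi : Integrable K :=
    (integrable_indicator_iff Metric.isOpen_ball.measurableSet).2 (integrableOn_helmholtzKernel k _)
  have hbi : Integrable b := hb.integrable_of_hasCompactSupport hb'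
  have h1 := hbi.convolution_integrand
    (μ := (volume : Measure R3)) (ContinuousLinearMap.mul ℝ ℂ) hKi
  have h2 := h1.bdd_mul (f := fun p : R3 × R3 => a p.1) (c := M)
    (ha.comp continuous_fst).aestronglyMeasurable (Filter.Eventually.of_forall fun p => hM _)
  refine h2.congr (Filter.Eventually.of_forall fun p => ?_)
  simp only [ContinuousLinearMap.mul_apply']
  by_cases h3 : a p.1 = 0
  · simp [h3]
  by_cases h4 : b p.2 = 0
  · simp [h4]
  have h5 := hR _ (subset_tsupport _ h3)
  have h6 := hS _ (subset_tsupport _ h4)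
  have h7 : p.1 - p.2 ∈ Metric.ball (0 : R3) (R + S + 1) := by
    rw [mem_ball_zero_iff]
    linarith [norm_sub_le p.1 p.2]
  rw [hK, Set.indicator_of_mem h7, g_eq_helmholtzKernel]
  ring

lemma integral_mul_volumePotential {k : ℝ} {a b : R3 → ℂ} (ha : Continuous a)
    (ha' : HasCompactSupport a) (hb : Continuous b) (hb' : HasCompactSupport b) :
    ∫ x, a x * volumePotential k b x = ∫ x, volumePotential k a x * b x := by
  calc ∫ x, a x * volumePotential k b x = ∫ x, ∫ y, a x * g k x y * b y := by
        simp only [volumePotential, ← integral_const_mul, mul_assoc]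
    _ = ∫ y, ∫ x, a x * g k x y * b y := integral_integral_swap (integrable_mul_g_mul ha ha' hb hb')
    _ = ∫ y, volumePotential k a y * b y := by
        simp only [volumePotential, ← integral_mul_const, g_comm k]
        congr 1; funext y; congr 1; funext x
        ring

lemma pd_comp_sub_left {φ : R3 → ℂ} (hφ : Differentiable ℝ φ) (x : R3) (i : Fin 3) :
    pd i (fun t => φ (x - t)) = fun t => -pd i φ (x - t) := by
  funext t
  have h1 : HasFDerivAt (fun t : R3 => x - t) (-ContinuousLinearMap.id ℝ R3) t :=
    (hasFDerivAt_id t).const_sub x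
  have := ((hφ (x - t)).hasFDerivAt.comp t h1).fderiv
  rw [pd]
  erw [this]
  simp [pd]

lemma laplace_comp_sub_left {φ : R3 → ℂ} (hφ : ContDiff ℝ 2 φ) (x t : R3) :
    laplace (fun t => φ (x - t)) t = laplace φ (x - t) := by
  simp only [laplace]
  refine Finset.sum_congr rfl fun i _ => ?_
  rw [pd_comp_sub_left (hφ.differentiable two_ne_zero), pd_neg, pd_comp_sub_left
    ((hφ.pd i (m := 1) (by norm_num)).differentiable one_ne_zero), neg_neg]

lemma volumePotential_laplace {k : ℝ} {φ : R3 → ℂ} (hφ : ContDiff ℝ 2 φ)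
    (hc : HasCompactSupport φ) (x : R3) :
    volumePotential k (fun y => laplace φ y + (k : ℂ) ^ 2 * φ y) x = -φ x := by
  rw [volumePotential_eq_integral_sub]
  have h := integral_helmholtzKernel_mul (k := k) (φ := fun t => φ (x - t))
    (hφ.comp (contDiff_const.sub contDiff_id)) (hc.comp_homeomorph (Homeomorph.subLeft x))
  simp only [laplace_comp_sub_left hφ, sub_zero] at h
  exact h

/-- The volume potential solves the Helmholtz equation weakly. -/
lemma integral_volumePotential_mul_laplace {k : ℝ} {h φ : R3 → ℂ} (hh : Continuous h)
    (hh' : HasCompactSupport h) (hφ : ContDiff ℝ 2 φ) (hc : HasCompactSupport φ) :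
    ∫ x, volumePotential k h x * (laplace φ x + (k : ℂ) ^ 2 * φ x) = -∫ x, h x * φ x := by
  have h1 : Continuous fun x => laplace φ x + (k : ℂ) ^ 2 * φ x :=
    hφ.continuous_laplace.add (continuous_const.mul hφ.continuous)
  have h2 : HasCompactSupport fun x => laplace φ x + (k : ℂ) ^ 2 * φ x :=
    hc.laplace.add hc.mul_left
  rw [← integral_mul_volumePotential hh hh' h1 h2]
  simp only [volumePotential_laplace hφ hc, mul_neg, integral_neg]

/-- A volume potential of class `C²` solves the Helmholtz equation pointwise. -/
lemma laplace_volumePotential {k : ℝ} {h : R3 → ℂ} (hh : Continuous h)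
    (hh' : HasCompactSupport h) (hV : ContDiff ℝ 2 (volumePotential k h)) (x : R3) :
    laplace (volumePotential k h) x = -(k : ℂ) ^ 2 * volumePotential k h x - h x := by
  set V := volumePotential k h with hVdef
  set u : R3 → ℂ := fun x => laplace V x + (k : ℂ) ^ 2 * V x + h x with hu
  have huc : Continuous u :=
    (hV.continuous_laplace.add (continuous_const.mul hV.continuous)).add hh
  have hz : ∀ᵐ x, u x = 0 := by
    refine ae_eq_zero_of_integral_contDiff_smul_eq_zero huc.locallyIntegrable fun φ hφ hφc => ?_
    set Φ : R3 → ℂ := fun x => (φ x : ℂ)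
    have hΦ : ContDiff ℝ 2 Φ :=
      (Complex.ofRealCLM.contDiff.comp hφ).of_le (WithTop.coe_le_coe.2 le_top)
    have hΦc : HasCompactSupport Φ := hφc.comp_left (g := fun r : ℝ => (r : ℂ)) rfl
    have hw := integral_volumePotential_mul_laplace (k := k) hh hh' hΦ hΦc
    rw [← hVdef] at hw
    have i1 : Integrable fun x => V x * laplace Φ x :=
      (hV.continuous.mul hΦ.continuous_laplace).integrable_of_hasCompactSupport hΦc.laplace.mul_left
    have i2 : Integrable fun x => V x * ((k : ℂ) ^ 2 * Φ x) :=
      (hV.continuous.mul (continuous_const.mul hΦ.continuous)).integrable_of_hasCompactSupport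
        hΦc.mul_left.mul_left
    have i3 : Integrable fun x => laplace V x * Φ x :=
      (hV.continuous_laplace.mul hΦ.continuous).integrable_of_hasCompactSupport hΦc.mul_left
    have i4 : Integrable fun x => h x * Φ x :=
      (hh.mul hΦ.continuous).integrable_of_hasCompactSupport hΦc.mul_left
    simp only [mul_add] at hw
    rw [integral_add i1 i2, integral_mul_laplace hV hΦ hΦc, ← integral_add i3 i2,
      eq_neg_iff_add_eq_zero] at hw
    have hi : Integrable fun x => laplace V x * Φ x + V x * ((k : ℂ) ^ 2 * Φ x) := i3.add i2
    rw [← integral_add hi i4] at hw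
    rw [← hw]
    congr 1; funext x
    simp only [hu, Complex.real_smul, Φ]
    ring
  have := congrFun ((huc.ae_eq_iff_eq volume continuous_const (g := fun _ => 0)).1 hz) x
  simp only [hu] at this
  linear_combination this

/-! ### Weak unique continuation -/

lemma pd_convolution {f h : R3 → ℂ} (hf : LocallyIntegrable f) (hc : HasCompactSupport h)
    (hh : ContDiff ℝ 1 h) (i : Fin 3) :
    pd i (f ⋆[ContinuousLinearMap.mul ℝ ℂ, volume] h) =
      (f ⋆[ContinuousLinearMap.mul ℝ ℂ, volume] pd i h) := by
  funext x
  rw [pd, (hc.hasFDerivAt_convolution_right _ hf hh x).fderiv]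
  rw [convolution_def, convolution_def, ContinuousLinearMap.integral_apply]
  · simp [pd]
  · exact ((hc.fderiv ℝ).convolutionExists_right _ hf (hh.continuous_fderiv one_ne_zero) x)

lemma laplace_convolution {f h : R3 → ℂ} (hf : LocallyIntegrable f) (hc : HasCompactSupport h)
    (hh : ContDiff ℝ 2 h) (x : R3) :
    laplace (f ⋆[ContinuousLinearMap.mul ℝ ℂ, volume] h) x = ∫ t, f t * laplace h (x - t) := by
  have h1 : ∀ i, ContDiff ℝ 1 (pd i h) := fun i => hh.pd i (by norm_num)
  simp only [laplace, Finset.mul_sum]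
  rw [integral_finsetSum]
  · refine Finset.sum_congr rfl fun i _ => ?_
    rw [pd_convolution hf hc (hh.of_le one_le_two), pd_convolution hf (hc.pd i) (h1 i),
      convolution_def]
    rfl
  · exact fun i _ => (((hc.pd i).pd i).convolutionExists_right (ContinuousLinearMap.mul ℝ ℂ) hf
      ((h1 i).continuous_pd i one_ne_zero) x)

/-- A sequence of bump functions shrinking to the origin. -/
def shrinkingBump (n : ℕ) : ContDiffBump (0 : R3) where
  rIn := 1 / (2 * ((n : ℝ) + 1))
  rOut := 1 / ((n : ℝ) + 1)
  rIn_pos := by positivity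
  rIn_lt_rOut := by
    apply one_div_lt_one_div_of_lt <;> linarith [(n.cast_nonneg : (0 : ℝ) ≤ n)]

lemma shrinkingBump_rOut_le (n : ℕ) : (shrinkingBump n).rOut ≤ 1 := by
  change 1 / ((n : ℝ) + 1) ≤ 1
  rw [div_le_one (by positivity)]
  linarith [(n.cast_nonneg : (0 : ℝ) ≤ n)]

/-- A smooth approximation of the identity. -/
def mollifier (n : ℕ) (x : R3) : ℂ := ((shrinkingBump n).normed volume x : ℝ)

lemma contDiff_mollifier (n : ℕ) : ContDiff ℝ 2 (mollifier n) :=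
  Complex.ofRealCLM.contDiff.comp (shrinkingBump n).contDiff_normed

lemma hasCompactSupport_mollifier (n : ℕ) : HasCompactSupport (mollifier n) :=
  (shrinkingBump n).hasCompactSupport_normed.comp_left (g := fun r : ℝ => (r : ℂ)) rfl

/-- Mollification of a function. -/
def mollify (n : ℕ) (h : R3 → ℂ) : R3 → ℂ :=
  h ⋆[ContinuousLinearMap.mul ℝ ℂ, volume] mollifier n

lemma mollify_eq (n : ℕ) (h : R3 → ℂ) (x : R3) :
    mollify n h x = ((shrinkingBump n).normed volume ⋆[ContinuousLinearMap.lsmul ℝ ℝ, volume] h) x := by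
  rw [mollify, convolution_def, convolution_def, ← integral_sub_left_eq_self _ volume x]
  simp only [ContinuousLinearMap.mul_apply', ContinuousLinearMap.lsmul_apply, sub_sub_cancel,
    mollifier, Complex.real_smul, mul_comm]

lemma tendsto_mollify {h : R3 → ℂ} (hh : Continuous h) (x : R3) :
    Filter.Tendsto (fun n => mollify n h x) Filter.atTop (𝓝 (h x)) := by
  simp only [mollify_eq]
  exact ContDiffBump.convolution_tendsto_right_of_continuous tendsto_one_div_add_atTop_nhds_zero_nat
    hh x

lemma norm_mollify_le {h : R3 → ℂ} (hh : Continuous h) {M : ℝ} (hM : ∀ x, ‖h x‖ ≤ M) (n : ℕ)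
    (x : R3) : ‖mollify n h x‖ ≤ 3 * M := by
  have h1 := (shrinkingBump n).dist_normed_convolution_le (μ := volume) (x₀ := x) (ε := 2 * M)
    hh.aestronglyMeasurable (fun y _ => by
      rw [dist_eq_norm]
      linarith [norm_sub_le (h y) (h x), hM y, hM x])
  rw [← mollify_eq, dist_eq_norm] at h1
  linarith [norm_sub_norm_le (mollify n h x) (h x), hM x]

lemma mollify_eq_zero {h : R3 → ℂ} (hh : Continuous h) {R : ℝ} (hR : ∀ x, h x ≠ 0 → ‖x‖ ≤ R)
    (n : ℕ) {x : R3} (hx : R + 1 ≤ ‖x‖) : mollify n h x = 0 := by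
  have h0 : ∀ y ∈ Metric.ball x 1, h y = 0 := fun y hy => by
    by_contra hne
    have := hR y hne
    rw [mem_ball_iff_norm'] at hy
    linarith [norm_sub_norm_le x y]
  have hx0 := h0 x (Metric.mem_ball_self one_pos)
  have h1 := (shrinkingBump n).dist_normed_convolution_le (μ := volume) (x₀ := x) (ε := 0)
    hh.aestronglyMeasurable (fun y hy => by
      rw [h0 y (Metric.ball_subset_ball (shrinkingBump_rOut_le n) hy), hx0, dist_self])
  rw [← mollify_eq, hx0, dist_zero_right] at h1
  exact norm_le_zero_iff.1 h1

lemma hasCompactSupport_mollify {h : R3 → ℂ} (hc : HasCompactSupport h) (n : ℕ) :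
    HasCompactSupport (mollify n h) :=
  hc.convolution _ (hasCompactSupport_mollifier n)

lemma contDiff_mollify {h : R3 → ℂ} (hh : Continuous h) (n : ℕ) :
    ContDiff ℝ 2 (mollify n h) :=
  (hasCompactSupport_mollifier n).contDiff_convolution_right _ hh.locallyIntegrable
    (contDiff_mollifier n)

lemma tendsto_integral_weight_mollify {h : R3 → ℂ} (hh : Continuous h) (hc : HasCompactSupport h)
    (τ c : ℝ) :
    Filter.Tendsto (fun n => ∫ x, Real.exp (τ * (x 0 + c) ^ 2) * ‖mollify n h x‖ ^ 2) Filter.atTop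
      (𝓝 (∫ x, Real.exp (τ * (x 0 + c) ^ 2) * ‖h x‖ ^ 2)) := by
  have hexp : Continuous fun x : R3 => Real.exp (τ * (x 0 + c) ^ 2) := by fun_prop
  obtain ⟨M, hM⟩ := hh.bounded_above_of_compact_support hc
  obtain ⟨R, hR⟩ := hc.isCompact.isBounded.exists_norm_le
  have hR' : ∀ x, h x ≠ 0 → ‖x‖ ≤ R := fun x hx => hR x (subset_tsupport _ hx)
  refine tendsto_integral_of_dominated_convergence
    ((Metric.closedBall (0 : R3) (R + 1)).indicator
      fun x => Real.exp (τ * (x 0 + c) ^ 2) * (3 * M) ^ 2) (fun n => ?_) ?_ (fun n => ?_) ?_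
  · exact (hexp.mul ((contDiff_mollify hh n).continuous.norm.pow 2)).aestronglyMeasurable
  · rw [integrable_indicator_iff measurableSet_closedBall]
    exact (hexp.mul continuous_const).continuousOn.integrableOn_compact (isCompact_closedBall _ _)
  · refine Filter.Eventually.of_forall fun x => ?_
    by_cases hx : x ∈ Metric.closedBall (0 : R3) (R + 1)
    · rw [Set.indicator_of_mem hx, Real.norm_of_nonneg (by positivity)]
      gcongr
      exact norm_mollify_le hh hM n x
    · rw [Set.indicator_of_notMem hx]
      rw [mem_closedBall_zero_iff, not_le] at hx
      simp [mollify_eq_zero hh hR' n hx.le]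
  · exact Filter.Eventually.of_forall fun x =>
      ((tendsto_mollify hh x).norm.pow 2).const_mul _

/-- Weak form of the unique continuation statement, for continuous functions. -/
lemma eq_zero_of_weak_laplace_le {ψ F : R3 → ℂ} (hψ : Continuous ψ) (hψc : HasCompactSupport ψ)
    (hF : Continuous F) (hFc : HasCompactSupport F)
    (hw : ∀ φ : R3 → ℂ, ContDiff ℝ 2 φ → HasCompactSupport φ →
      ∫ x, ψ x * laplace φ x = ∫ x, F x * φ x)
    {C : ℝ} (hle : ∀ x, ‖F x‖ ≤ C * ‖ψ x‖) (x : R3) : ψ x = 0 := by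
  have hlap : ∀ n x, laplace (mollify n ψ) x = mollify n F x := fun n x => by
    have h1 := hw (fun t => mollifier n (x - t))
      ((contDiff_mollifier n).comp (contDiff_const.sub contDiff_id))
      ((hasCompactSupport_mollifier n).comp_homeomorph (Homeomorph.subLeft x))
    simp only [laplace_comp_sub_left (contDiff_mollifier n)] at h1
    rw [mollify, laplace_convolution hψ.locallyIntegrable (hasCompactSupport_mollifier n)
      (contDiff_mollifier n), h1]
    rfl
  obtain ⟨R, hR⟩ := hψc.isCompact.isBounded.exists_norm_le
  have hR' : ∀ x, ψ x ≠ 0 → ‖x‖ ≤ R := fun x hx => hR x (subset_tsupport _ hx)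
  set τ : ℝ := 3 * C ^ 2 + 1 with hτ
  have hτ1 : 1 ≤ τ := by rw [hτ]; nlinarith [sq_nonneg C]
  set c : ℝ := R + 2 with hc
  have hcar : ∀ n, τ * ∫ x, Real.exp (τ * (x 0 + c) ^ 2) * ‖mollify n ψ x‖ ^ 2 ≤
      3 * ∫ x, Real.exp (τ * (x 0 + c) ^ 2) * ‖mollify n F x‖ ^ 2 := fun n => by
    have hm := contDiff_mollify hψ n
    have hmc := hasCompactSupport_mollify hψc n
    have h1 := carleman_estimate_complex (c := c) hτ1 hm hmc (fun x hx => by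
      have h2 : ‖x‖ < R + 1 := by
        by_contra! h3
        exact hx (mollify_eq_zero hψ hR' n h3)
      have h3 := PiLp.norm_apply_le x 0
      rw [Real.norm_eq_abs] at h3
      linarith [neg_abs_le (x 0)])
    simp only [hlap] at h1
    refine le_trans (mul_le_mul_of_nonneg_left ?_ (by linarith)) h1
    refine integral_mono (integrable_weight_sq hmc hm.continuous τ c)
      (integrable_weight_energy hmc (hm.of_le one_le_two) τ c) fun x => ?_
    have : 0 ≤ ∑ i, ‖pd i (mollify n ψ) x‖ ^ 2 := by positivity
    dsimp only
    gcongr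
    linarith
  have hlim := le_of_tendsto_of_tendsto' ((tendsto_integral_weight_mollify hψ hψc τ c).const_mul τ)
    ((tendsto_integral_weight_mollify hF hFc τ c).const_mul 3) hcar
  have hi := integrable_weight_sq hψc hψ τ c
  have hFψ : ∫ x, Real.exp (τ * (x 0 + c) ^ 2) * ‖F x‖ ^ 2 ≤
      C ^ 2 * ∫ x, Real.exp (τ * (x 0 + c) ^ 2) * ‖ψ x‖ ^ 2 := by
    rw [← integral_const_mul]
    refine integral_mono (integrable_weight_sq hFc hF τ c) (hi.const_mul _) fun x => ?_
    have h1 : ‖F x‖ ^ 2 ≤ (C * ‖ψ x‖) ^ 2 := pow_le_pow_left₀ (norm_nonneg _) (hle x) 2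
    dsimp only
    nlinarith [Real.exp_pos (τ * (x 0 + c) ^ 2)]
  have hnn : 0 ≤ ∫ x, Real.exp (τ * (x 0 + c) ^ 2) * ‖ψ x‖ ^ 2 :=
    integral_nonneg fun x => by positivity
  have h0 : ∫ x, Real.exp (τ * (x 0 + c) ^ 2) * ‖ψ x‖ ^ 2 = 0 := by
    rw [hτ] at hlim hFψ hnn ⊢
    nlinarith
  have hexp : Continuous fun x : R3 => Real.exp (τ * (x 0 + c) ^ 2) := by fun_prop
  have hcont : Continuous fun x : R3 => Real.exp (τ * (x 0 + c) ^ 2) * ‖ψ x‖ ^ 2 :=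
    hexp.mul (hψ.norm.pow 2)
  have := eq_zero_of_integral_eq_zero hcont (fun x => by positivity) hi h0 x
  simpa [(Real.exp_pos _).ne'] using this

/-! ### Integrals over compact sets depending on a parameter -/

section CompactIntegral

variable {X Y : Type*} [TopologicalSpace X] [MeasureSpace X]
  [BorelSpace X] [IsLocallyFiniteMeasure (volume : Measure X)]
  [TopologicalSpace Y] [SecondCountableTopology Y] [MeasureSpace Y] [BorelSpace Y]
  [IsLocallyFiniteMeasure (volume : Measure Y)] [SFinite (volume : Measure Y)]

lemma setIntegral_setIntegral_swap [SFinite (volume : Measure X)] {f : X → Y → ℂ}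
    (hf : Continuous f.uncurry) {K : Set X}
    {L : Set Y} (hK : IsCompact K) (hL : IsCompact L) :
    ∫ x in K, ∫ y in L, f x y = ∫ y in L, ∫ x in K, f x y := by
  apply integral_integral_swap
  rw [Measure.prod_restrict]
  have hfin : (volume.prod volume : Measure (X × Y)).restrict (K ×ˢ L) Set.univ < ⊤ := by
    rw [Measure.restrict_apply_univ, Measure.prod_prod]
    exact ENNReal.mul_lt_top hK.measure_lt_top hL.measure_lt_top
  have : IsFiniteMeasure ((volume.prod volume : Measure (X × Y)).restrict (K ×ˢ L)) := ⟨hfin⟩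
  obtain ⟨M, hM⟩ := (hK.prod hL).exists_bound_of_continuousOn hf.continuousOn
  refine Integrable.of_bound hf.aestronglyMeasurable M ?_
  have hcl : MeasurableSet {p : X × Y | ‖f.uncurry p‖ ≤ M} :=
    (isClosed_le hf.norm continuous_const).measurableSet
  rw [ae_restrict_iff hcl]
  exact Filter.Eventually.of_forall hM

lemma hasDerivAt_setIntegral {𝕜 : Type*} [RCLike 𝕜] [NormedSpace 𝕜 ℂ] {f f' : 𝕜 → X → ℂ}
    (hf : Continuous f.uncurry) (hf' : Continuous f'.uncurry)
    (h : ∀ a x, HasDerivAt (fun s => f s x) (f' a x) a) {K : Set X} (hK : IsCompact K) (a : 𝕜) :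
    HasDerivAt (fun s => ∫ x in K, f s x) (∫ x in K, f' a x) a := by
  have hfs : ∀ s, Continuous (f s) := fun s => hf.comp (by fun_prop : Continuous fun x => (s, x))
  have hfs' : Continuous (f' a) := hf'.comp (by fun_prop : Continuous fun x => (a, x))
  have hfin : (volume.restrict K : Measure X) Set.univ < ⊤ := by
    rw [Measure.restrict_apply_univ]
    exact hK.measure_lt_top
  have : IsFiniteMeasure (volume.restrict K : Measure X) := ⟨hfin⟩
  have key : ∀ p : 𝕜 → X → ℂ, Continuous p.uncurry → ∃ M : ℝ,
      ∀ᵐ x ∂(volume.restrict K), ∀ s ∈ Metric.closedBall a 1, ‖p s x‖ ≤ M := fun p hp => by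
    obtain ⟨M, hM⟩ := ((isCompact_closedBall a 1).prod hK).exists_bound_of_continuousOn
      hp.continuousOn
    refine ⟨M, ?_⟩
    have hps : ∀ s, Continuous (p s) := fun s => hp.comp (by fun_prop : Continuous fun x => (s, x))
    have hcl : MeasurableSet {x : X | ∀ s ∈ Metric.closedBall a 1, ‖p s x‖ ≤ M} := by
      simp only [Set.ofPred_forall]
      exact (isClosed_biInter fun s _ => isClosed_le (hps s).norm continuous_const).measurableSet
    rw [ae_restrict_iff hcl]
    exact Filter.Eventually.of_forall fun x hx s hs => hM (s, x) ⟨hs, hx⟩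
  obtain ⟨M, hM⟩ := key f hf
  obtain ⟨M', hM'⟩ := key f' hf'
  refine (hasDerivAt_integral_of_dominated_loc_of_deriv_le (F := f) (F' := f')
    (bound := fun _ => M') (Metric.closedBall_mem_nhds a one_pos)
    (Filter.Eventually.of_forall fun s => (hfs s).aestronglyMeasurable)
    (Integrable.of_bound (hfs a).aestronglyMeasurable M ?_) hfs'.aestronglyMeasurable hM'
    (integrable_const _) (Filter.Eventually.of_forall fun x s _ => h s x)).2
  filter_upwards [hM] with x hx using hx a (Metric.mem_closedBall_self zero_le_one)

end CompactIntegral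

lemma setIntegral_Icc_deriv {f f' : ℝ → ℂ} (h : ∀ t, HasDerivAt f (f' t) t) (hf' : Continuous f')
    {a b : ℝ} (hab : a ≤ b) : ∫ t in Set.Icc a b, f' t = f b - f a := by
  rw [integral_Icc_eq_integral_Ioc, ← intervalIntegral.integral_of_le hab]
  exact intervalIntegral.integral_eq_sub_of_hasDerivAt (fun t _ => h t)
    (hf'.intervalIntegrable _ _)

lemma hasDerivAt_setIntegral_setIntegral {f f' : ℝ → ℝ → ℝ → ℂ}
    (hf : Continuous fun p : ℝ × ℝ × ℝ => f p.1 p.2.1 p.2.2)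
    (hf' : Continuous fun p : ℝ × ℝ × ℝ => f' p.1 p.2.1 p.2.2)
    (h : ∀ s x y, HasDerivAt (fun s => f s x y) (f' s x y) s) {K L : Set ℝ} (hK : IsCompact K)
    (hL : IsCompact L) (s : ℝ) :
    HasDerivAt (fun s => ∫ x in K, ∫ y in L, f s x y) (∫ x in K, ∫ y in L, f' s x y) s := by
  have key : ∀ p : ℝ → ℝ → ℝ → ℂ, Continuous (fun q : ℝ × ℝ × ℝ => p q.1 q.2.1 q.2.2) →
      Continuous fun q : ℝ × ℝ => ∫ y in L, p q.1 q.2 y := fun p hp =>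
    continuous_parametric_integral_of_continuous (f := fun (q : ℝ × ℝ) (y : ℝ) => p q.1 q.2 y)
      (hp.comp (by fun_prop : Continuous fun q : (ℝ × ℝ) × ℝ => (q.1.1, q.1.2, q.2))) hL
  refine hasDerivAt_setIntegral (f := fun s x => ∫ y in L, f s x y)
    (f' := fun s x => ∫ y in L, f' s x y) (key f hf) (key f' hf') (fun s x => ?_) hK s
  exact hasDerivAt_setIntegral (f := fun s y => f s x y) (f' := fun s y => f' s x y)
    (hf.comp (by fun_prop : Continuous fun q : ℝ × ℝ => (q.1, x, q.2)))
    (hf'.comp (by fun_prop : Continuous fun q : ℝ × ℝ => (q.1, x, q.2)))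
    (fun s y => h s x y) hL s

/-- Green's formula on a rectangle, for a vector field periodic in the first variable. -/
lemma setIntegral_rectangle_deriv_sub {a a' b b' : ℝ → ℝ → ℂ} (ha : Continuous a.uncurry)
    (hac : Continuous a'.uncurry) (hbc : Continuous b'.uncurry)
    (ha' : ∀ s t, HasDerivAt (fun t => a s t) (a' s t) t)
    (hb' : ∀ s t, HasDerivAt (fun s => b s t) (b' s t) s) {S T : ℝ} (hS : 0 ≤ S) (hT : 0 ≤ T)
    (hb : ∀ t, b S t = b 0 t) :
    ∫ s in Set.Icc 0 S, ∫ t in Set.Icc 0 T, (b' s t - a' s t) =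
      (∫ s in Set.Icc 0 S, a s 0) - ∫ s in Set.Icc 0 S, a s T := by
  have hrow : ∀ {p : ℝ → ℝ → ℂ}, Continuous p.uncurry → ∀ s, Continuous (p s) :=
    fun hp s => hp.comp (by fun_prop : Continuous fun t : ℝ => (s, t))
  have hcol : ∀ {p : ℝ → ℝ → ℂ}, Continuous p.uncurry → ∀ t, Continuous fun s => p s t :=
    fun hp t => hp.comp (by fun_prop : Continuous fun s : ℝ => (s, t))
  have ha1 : ∀ s, ∫ t in Set.Icc 0 T, a' s t = a s T - a s 0 := fun s =>
    setIntegral_Icc_deriv (ha' s) (hrow hac s) hT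
  have hb1 : ∀ t, ∫ s in Set.Icc 0 S, b' s t = 0 := fun t => by
    rw [setIntegral_Icc_deriv (fun s => hb' s t) (hcol hbc t) hS, hb, sub_self]
  have hbs : Continuous fun s => ∫ t in Set.Icc 0 T, b' s t :=
    continuous_parametric_integral_of_continuous hbc isCompact_Icc
  calc ∫ s in Set.Icc 0 S, ∫ t in Set.Icc 0 T, (b' s t - a' s t)
      = ∫ s in Set.Icc 0 S, ((∫ t in Set.Icc 0 T, b' s t) - (a s T - a s 0)) := by
        congr 1; funext s
        rw [integral_sub (hrow hbc s).integrableOn_Icc (hrow hac s).integrableOn_Icc, ha1]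
    _ = _ := by
        have h1 : Continuous fun s => a s T - a s 0 := (hcol ha T).sub (hcol ha 0)
        rw [integral_sub hbs.integrableOn_Icc h1.integrableOn_Icc,
          integral_sub (hcol ha T).integrableOn_Icc (hcol ha 0).integrableOn_Icc,
          setIntegral_setIntegral_swap hbc isCompact_Icc isCompact_Icc]
        simp only [hb1, integral_zero]
        ring

/-! ### Superpositions of plane waves -/

/-- Plane wave in polar coordinates: `α`, `φ` are the angles of the direction of propagation and
`β` is the polar angle of the position. -/
def polarPhase (κ : ℝ) (α : ℂ) (φ β : ℝ) : ℂ :=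
  Complex.exp (Complex.I * κ * (Complex.sin β * (Complex.sin α * Complex.cos φ) +
    Complex.cos β * Complex.cos α))

/-- Superposition of plane waves with polar angle on the segment from `c` to `c + d * T`. -/
def polarWave (c d : ℂ) (T κ β : ℝ) : ℂ :=
  ∫ φ in Set.Icc 0 (2 * Real.pi), ∫ τ in Set.Icc 0 T,
    polarPhase κ (c + d * (τ : ℂ)) φ β * (d * Complex.sin (c + d * (τ : ℂ)))

/-- Boundary term in the `β`-derivative of `polarWave`. -/
def polarBoundary (κ : ℝ) (α : ℂ) (β : ℝ) : ℂ :=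
  ∫ φ in Set.Icc 0 (2 * Real.pi), Complex.sin α * Complex.cos (φ : ℂ) * polarPhase κ α φ β

lemma hasDerivAt_polarPhase_position (κ : ℝ) (α : ℂ) (φ β : ℝ) :
    HasDerivAt (fun β : ℝ => polarPhase κ α φ β)
      (polarPhase κ α φ β * (Complex.I * κ * (Complex.cos β * (Complex.sin α * Complex.cos φ) -
        Complex.sin β * Complex.cos α))) β := by
  have h1 := ((((Complex.hasDerivAt_sin (β : ℂ)).mul_const (Complex.sin α * Complex.cos φ)).add
    ((Complex.hasDerivAt_cos (β : ℂ)).mul_const (Complex.cos α))).const_mul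
      (Complex.I * κ)).cexp.comp_ofReal
  simpa only [polarPhase, neg_mul, ← sub_eq_add_neg] using! h1

lemma hasDerivAt_polarPhase_azimuth (κ : ℝ) (α : ℂ) (φ β : ℝ) :
    HasDerivAt (fun φ : ℝ => Complex.cos α * (Complex.sin φ * polarPhase κ α φ β))
      (Complex.cos α * (Complex.cos φ * polarPhase κ α φ β + Complex.sin φ *
        (polarPhase κ α φ β * (Complex.I * κ * (Complex.sin β * (Complex.sin α *
          -Complex.sin φ)))))) φ := by
  have h0 := (((((Complex.hasDerivAt_cos (φ : ℂ)).const_mul (Complex.sin α)).const_mul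
    (Complex.sin β)).add_const (Complex.cos β * Complex.cos α)).const_mul
      (Complex.I * κ)).cexp
  have h1 := (((Complex.hasDerivAt_sin (φ : ℂ)).mul h0).const_mul (Complex.cos α)).comp_ofReal
  simpa only [polarPhase] using! h1

lemma hasDerivAt_polarPhase_path (c d : ℂ) (κ φ β τ : ℝ) :
    HasDerivAt (fun τ : ℝ => Complex.sin (c + d * (τ : ℂ)) * Complex.cos φ *
        polarPhase κ (c + d * (τ : ℂ)) φ β)
      (d * (Complex.cos (c + d * τ) * Complex.cos φ * polarPhase κ (c + d * τ) φ β +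
        Complex.sin (c + d * τ) * Complex.cos φ * (polarPhase κ (c + d * τ) φ β *
          (Complex.I * κ * (Complex.sin β * (Complex.cos (c + d * τ) * Complex.cos φ) -
            Complex.cos β * Complex.sin (c + d * τ)))))) τ := by
  have h2 : HasDerivAt (fun τ : ℂ => c + d * τ) d (τ : ℂ) := by
    simpa using ((hasDerivAt_id (τ : ℂ)).const_mul d).const_add c
  have h0 := ((((h2.csin.mul_const (Complex.cos φ)).const_mul (Complex.sin β)).add
    (h2.ccos.const_mul (Complex.cos β))).const_mul (Complex.I * κ)).cexp
  have h1 := ((h2.csin.mul_const (Complex.cos φ)).mul h0).comp_ofReal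
  refine HasDerivAt.congr_deriv (by simpa only [polarPhase] using! h1) ?_
  simp only [polarPhase, Pi.add_apply]
  ring

/-- Derivative of the integrand of `polarWave` in `β`. -/
def polarIntegrand (c d : ℂ) (κ β φ τ : ℝ) : ℂ :=
  polarPhase κ (c + d * τ) φ β * (Complex.I * κ *
    (Complex.cos β * (Complex.sin (c + d * τ) * Complex.cos φ) -
        Complex.sin β * Complex.cos (c + d * τ))) * (d * Complex.sin (c + d * τ))

lemma hasDerivAt_polarWave (c d : ℂ) {T : ℝ} (hT : 0 ≤ T) (κ β : ℝ) :
    HasDerivAt (polarWave c d T κ)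
      (polarBoundary κ c β - polarBoundary κ (c + d * T) β) β := by
  have h0 : HasDerivAt (polarWave c d T κ) (∫ φ in Set.Icc 0 (2 * Real.pi), ∫ τ in Set.Icc 0 T,
      polarIntegrand c d κ β φ τ) β := by
    refine hasDerivAt_setIntegral_setIntegral (f := fun β φ τ => polarPhase κ (c + d * (τ : ℂ)) φ β *
      (d * Complex.sin (c + d * (τ : ℂ)))) (f' := polarIntegrand c d κ) ?_ ?_
      (fun β φ τ => (hasDerivAt_polarPhase_position κ _ φ β).mul_const _)
      isCompact_Icc isCompact_Icc β
    · simp only [polarPhase]; fun_prop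
    · simp only [polarIntegrand, polarPhase]; fun_prop
  refine h0.congr_deriv ?_
  set A : ℝ → ℝ → ℂ := fun φ τ => d * (Complex.cos (c + d * τ) * Complex.cos φ *
    polarPhase κ (c + d * τ) φ β +
        Complex.sin (c + d * τ) * Complex.cos φ * (polarPhase κ (c + d * τ) φ β *
          (Complex.I * κ * (Complex.sin β * (Complex.cos (c + d * τ) * Complex.cos φ) -
            Complex.cos β * Complex.sin (c + d * τ))))) with hA
  set B : ℝ → ℝ → ℂ := fun φ τ => d * (Complex.cos (c + d * τ) * (Complex.cos φ *
    polarPhase κ (c + d * τ) φ β + Complex.sin φ *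
        (polarPhase κ (c + d * τ) φ β * (Complex.I * κ * (Complex.sin β *
          (Complex.sin (c + d * τ) * -Complex.sin φ)))))) with hB
  have hac : Continuous (fun (φ τ : ℝ) => Complex.sin (c + d * (τ : ℂ)) * Complex.cos φ *
      polarPhase κ (c + d * (τ : ℂ)) φ β).uncurry := by
    simp only [polarPhase, Function.uncurry_def]; fun_prop
  have hAc : Continuous A.uncurry := by
    simp only [hA, polarPhase, Function.uncurry_def]; fun_prop
  have hBc : Continuous B.uncurry := by
    simp only [hB, polarPhase, Function.uncurry_def]; fun_prop
  have hDAB : ∀ φ τ, polarIntegrand c d κ β φ τ = B φ τ - A φ τ := fun φ τ => by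
    simp only [polarIntegrand, hA, hB]
    linear_combination (polarPhase κ (c + d * τ) φ β * Complex.I * κ * Complex.sin β *
      Complex.cos (c + d * τ) * d * Complex.sin (c + d * τ)) *
        (Complex.sin_sq_add_cos_sq (φ : ℂ))
  have h1 := setIntegral_rectangle_deriv_sub hac hAc hBc
    (hasDerivAt_polarPhase_path c d κ · β ·)
    (fun φ τ => (hasDerivAt_polarPhase_azimuth κ (c + d * τ) φ β).const_mul d)
    (S := 2 * Real.pi) (by positivity) hT (fun t => by simp [Complex.sin_two_pi])
  simp only [hDAB, h1, polarBoundary, Complex.ofReal_zero, mul_zero, add_zero]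

lemma polarWave_zero (c d : ℂ) {T κ : ℝ} (hT : 0 ≤ T) (hκ : κ ≠ 0) :
    polarWave c d T κ 0 = 2 * Real.pi * ((Complex.exp (Complex.I * κ * Complex.cos c) -
      Complex.exp (Complex.I * κ * Complex.cos (c + d * T))) / (Complex.I * κ)) := by
  have hκ' : (κ : ℂ) ≠ 0 := by exact_mod_cast hκ
  have hd : ∀ τ : ℝ, HasDerivAt
      (fun τ : ℝ => -(Complex.exp (Complex.I * κ * Complex.cos (c + d * (τ : ℂ))) / (Complex.I * κ)))
      (Complex.exp (Complex.I * κ * Complex.cos (c + d * τ)) * (d * Complex.sin (c + d * τ))) τ :=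
    fun τ => by
      have h2 : HasDerivAt (fun τ : ℂ => c + d * τ) d (τ : ℂ) := by
        simpa using ((hasDerivAt_id (τ : ℂ)).const_mul d).const_add c
      refine HasDerivAt.congr_deriv
        ((((h2.ccos.const_mul (Complex.I * κ)).cexp.div_const (Complex.I * κ)).neg).comp_ofReal) ?_
      field_simp
  have h1 := setIntegral_Icc_deriv hd (by fun_prop) hT
  have h2 : ∀ (α : ℂ) (φ : ℝ), polarPhase κ α φ 0 = Complex.exp (Complex.I * κ * Complex.cos α) :=
    fun α φ => by simp [polarPhase]
  simp only [polarWave, h2, h1]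
  rw [setIntegral_const]
  simp only [Real.volume_real_Icc_of_le (by positivity : (0 : ℝ) ≤ 2 * Real.pi), sub_zero,
    Complex.real_smul, Complex.ofReal_mul, Complex.ofReal_ofNat, Complex.ofReal_zero, mul_zero,
    add_zero]
  ring

lemma polarBoundary_of_sin_eq_zero {α : ℂ} (h : Complex.sin α = 0) (κ β : ℝ) :
    polarBoundary κ α β = 0 := by
  simp [polarBoundary, h]

lemma polarWave_zero_pi {κ : ℝ} (hκ : κ ≠ 0) (β : ℝ) :
    polarWave 0 1 Real.pi κ β = 4 * Real.pi * (Complex.sin κ / κ) := by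
  have h1 : ∀ β, HasDerivAt (polarWave 0 1 Real.pi κ) 0 β := fun β => by
    refine (hasDerivAt_polarWave 0 1 Real.pi_pos.le κ β).congr_deriv ?_
    rw [polarBoundary_of_sin_eq_zero (by simp), polarBoundary_of_sin_eq_zero (by simp), sub_zero]
  have h2 : polarWave 0 1 Real.pi κ β = polarWave 0 1 Real.pi κ 0 :=
    is_const_of_deriv_eq_zero (fun β => (h1 β).differentiableAt) (fun β => (h1 β).deriv) _ _
  have hκ' : (κ : ℂ) ≠ 0 := by exact_mod_cast hκ
  rw [h2, polarWave_zero 0 1 Real.pi_pos.le hκ, Complex.sin]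
  simp only [Complex.cos_zero, one_mul, zero_add, Complex.cos_pi, mul_one, mul_neg]
  field_simp
  rw [Complex.I_sq]
  ring_nf

lemma sin_pi_div_two_sub_mul_I (T : ℝ) :
    Complex.sin (Real.pi / 2 + -Complex.I * T) = Real.cosh T := by
  rw [neg_mul, ← sub_eq_add_neg, Complex.sin_pi_div_two_sub, mul_comm, Complex.cos_mul_I,
    Complex.ofReal_cosh]

lemma cos_pi_div_two_sub_mul_I (T : ℝ) :
    Complex.cos (Real.pi / 2 + -Complex.I * T) = Complex.I * Real.sinh T := by
  rw [neg_mul, ← sub_eq_add_neg, Complex.cos_pi_div_two_sub, mul_comm, Complex.sin_mul_I,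
    Complex.ofReal_sinh, mul_comm]

lemma norm_polarPhase_tail (κ T φ β : ℝ) :
    ‖polarPhase κ (Real.pi / 2 + -Complex.I * T) φ β‖ =
      Real.exp (-(κ * Real.cos β * Real.sinh T)) := by
  rw [polarPhase, Complex.norm_exp, sin_pi_div_two_sub_mul_I, cos_pi_div_two_sub_mul_I]
  congr 1
  simp only [← Complex.ofReal_sin, ← Complex.ofReal_cos, Complex.mul_re, Complex.mul_im,
    Complex.add_re, Complex.add_im, Complex.I_re, Complex.I_im, Complex.ofReal_re,
    Complex.ofReal_im]
  ring

lemma norm_polarBoundary_tail_le (κ T β : ℝ) :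
    ‖polarBoundary κ (Real.pi / 2 + -Complex.I * T) β‖ ≤
      2 * Real.pi * (Real.cosh T * Real.exp (-(κ * Real.cos β * Real.sinh T))) := by
  rw [polarBoundary]
  refine (norm_setIntegral_le_of_norm_le_const measure_Icc_lt_top
    (C := Real.cosh T * Real.exp (-(κ * Real.cos β * Real.sinh T))) fun φ _ => ?_).trans ?_
  · rw [norm_mul, norm_mul, norm_polarPhase_tail, sin_pi_div_two_sub_mul_I, Complex.norm_real,
      Real.norm_of_nonneg (Real.cosh_pos T).le, ← Complex.ofReal_cos, Complex.norm_real,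
      Real.norm_eq_abs]
    gcongr
    exact mul_le_of_le_one_right (Real.cosh_pos T).le (Real.abs_cos_le_one φ)
  · rw [Real.volume_real_Icc_of_le (by positivity), sub_zero, mul_comm]

/-- Truncated Weyl integral in polar coordinates. -/
lemma norm_polarWave_weyl_sub_le {κ β T : ℝ} (hκ : 0 < κ) (hβ : 0 ≤ β) (hβ' : β ≤ Real.pi / 2)
    (hT : 0 ≤ T) :
    ‖polarWave 0 1 (Real.pi / 2) κ β + polarWave (Real.pi / 2) (-Complex.I) T κ β -
      2 * Real.pi * (Complex.exp (Complex.I * κ) / (Complex.I * κ))‖ ≤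
      2 * Real.pi * (Real.exp (-(κ * Real.sinh T)) / κ) +
        2 * Real.pi * (Real.cosh T * Real.exp (-(κ * Real.cos β * Real.sinh T))) * β := by
  have hpi : (0 : ℝ) ≤ Real.pi / 2 := by positivity
  set S : ℝ → ℂ := fun β =>
    polarWave 0 1 (Real.pi / 2) κ β + polarWave (Real.pi / 2) (-Complex.I) T κ β with hS
  have hd : ∀ β, HasDerivAt S (-polarBoundary κ (Real.pi / 2 + -Complex.I * T) β) β := fun β => by
    refine ((hasDerivAt_polarWave 0 1 hpi κ β).add
      (hasDerivAt_polarWave (Real.pi / 2) (-Complex.I) hT κ β)).congr_deriv ?_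
    rw [polarBoundary_of_sin_eq_zero (by simp)]
    push_cast
    rw [zero_add, one_mul]
    ring
  have hsinh : 0 ≤ Real.sinh T := Real.sinh_nonneg_iff.2 hT
  have h1 := norm_image_sub_le_of_norm_deriv_le_segment' (f := S) (a := 0) (b := β)
    (C := 2 * Real.pi * (Real.cosh T * Real.exp (-(κ * Real.cos β * Real.sinh T))))
    (fun s _ => (hd s).hasDerivWithinAt) (fun s hs => by
      rw [norm_neg]
      refine (norm_polarBoundary_tail_le κ T s).trans ?_
      have : Real.cos β ≤ Real.cos s :=
        Real.cos_le_cos_of_nonneg_of_le_pi hs.1 (by linarith [Real.pi_pos]) hs.2.le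
      have := Real.cosh_pos T
      gcongr) β ⟨hβ, le_rfl⟩
  have h2 : S 0 - 2 * Real.pi * (Complex.exp (Complex.I * κ) / (Complex.I * κ)) =
      -(2 * Real.pi * (Complex.exp (-(κ * Real.sinh T) : ℝ) / (Complex.I * κ))) := by
    simp only [hS]
    rw [polarWave_zero 0 1 hpi hκ.ne', polarWave_zero _ _ hT hκ.ne', cos_pi_div_two_sub_mul_I]
    have h3 : Complex.I * κ * (Complex.I * Real.sinh T) = ((-(κ * Real.sinh T) : ℝ) : ℂ) := by
      push_cast
      linear_combination (κ * Complex.sinh T) * Complex.I_sq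
    rw [h3]
    simp only [Complex.cos_zero, mul_one, one_mul, zero_add, Complex.ofReal_div,
      Complex.ofReal_ofNat, Complex.cos_pi_div_two, mul_zero, Complex.exp_zero]
    ring
  have h4 : ‖S 0 - 2 * Real.pi * (Complex.exp (Complex.I * κ) / (Complex.I * κ))‖ =
      2 * Real.pi * (Real.exp (-(κ * Real.sinh T)) / κ) := by
    rw [h2, norm_neg, norm_mul, norm_mul, norm_div, norm_mul, Complex.norm_I, one_mul,
      Complex.norm_real, Complex.norm_real, ← Complex.ofReal_exp, Complex.norm_real,
      Real.norm_of_nonneg (Real.exp_pos _).le, Real.norm_of_nonneg hκ.le,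
      Real.norm_of_nonneg Real.pi_pos.le, Complex.norm_ofNat]
  calc _ = ‖(S 0 - 2 * Real.pi * (Complex.exp (Complex.I * κ) / (Complex.I * κ))) +
        (S β - S 0)‖ := by
        congr 1
        simp only [hS]
        ring
    _ ≤ _ := by
        refine (norm_add_le _ _).trans ?_
        rw [h4]
        rw [sub_zero] at h1
        linarith

/-- Plane wave with (complex) direction of propagation of polar angle `α` and azimuth `φ`. -/
def planeWave (k : ℝ) (α : ℂ) (φ : ℝ) (x : R3) : ℂ :=
  Complex.exp (Complex.I * k * (Complex.sin α * (x 0 * Complex.cos φ + x 1 * Complex.sin φ) +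
    Complex.cos α * x 2))

/-- Superposition of plane waves with polar angle on the segment from `c` to `c + d * T`. -/
def waveIntegral (c d : ℂ) (T k : ℝ) (x : R3) : ℂ :=
  ∫ φ in Set.Icc 0 (2 * Real.pi), ∫ τ in Set.Icc 0 T,
    planeWave k (c + d * (τ : ℂ)) φ x * (d * Complex.sin (c + d * (τ : ℂ)))

lemma planeWave_sub (k : ℝ) (α : ℂ) (φ : ℝ) (x y : R3) :
    planeWave k α φ (x - y) = planeWave k α φ x * planeWave k α φ (-y) := by
  rw [planeWave, planeWave, planeWave, ← Complex.exp_add]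
  congr 1
  simp only [PiLp.sub_apply, PiLp.neg_apply, Complex.ofReal_sub, Complex.ofReal_neg]
  ring

lemma norm_eq_sqrt_three (x : R3) : ‖x‖ ^ 2 = x 0 ^ 2 + x 1 ^ 2 + x 2 ^ 2 := by
  rw [EuclideanSpace.norm_sq_eq, Fin.sum_univ_three]
  simp only [Real.norm_eq_abs, sq_abs]

lemma waveIntegral_eq_polarWave {x : R3} {r φ₀ β : ℝ}
    (h0 : x 0 = r * Real.sin β * Real.cos φ₀) (h1 : x 1 = r * Real.sin β * Real.sin φ₀)
    (h2 : x 2 = r * Real.cos β) (c d : ℂ) (T k : ℝ) :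
    waveIntegral c d T k x = polarWave c d T (k * r) β := by
  set G : ℝ → ℂ := fun φ => ∫ τ in Set.Icc 0 T,
    polarPhase (k * r) (c + d * (τ : ℂ)) φ β * (d * Complex.sin (c + d * (τ : ℂ))) with hG
  have hG2 : Function.Periodic G (2 * Real.pi) := fun φ => by
    simp only [hG, polarPhase, Complex.ofReal_add, Complex.ofReal_mul, Complex.ofReal_ofNat,
      Complex.cos_add_two_pi]
  have h3 : ∀ α φ, planeWave k α φ x = polarPhase (k * r) α (φ - φ₀) β := fun α φ => by
    rw [planeWave, polarPhase, h0, h1, h2]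
    congr 1
    push_cast
    rw [Complex.cos_sub]
    ring
  have hpi : (0 : ℝ) ≤ 2 * Real.pi := by positivity
  calc waveIntegral c d T k x = ∫ φ in Set.Icc 0 (2 * Real.pi), G (φ - φ₀) := by
        simp only [waveIntegral, h3, hG]
    _ = ∫ φ in (0 : ℝ)..(2 * Real.pi), G (φ - φ₀) := by
        rw [integral_Icc_eq_integral_Ioc, intervalIntegral.integral_of_le hpi]
    _ = ∫ φ in (-φ₀)..(-φ₀ + 2 * Real.pi), G φ := by
        rw [intervalIntegral.integral_comp_sub_right G φ₀]
        congr 1 <;> ring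
    _ = ∫ φ in (0 : ℝ)..(0 + 2 * Real.pi), G φ := hG2.intervalIntegral_add_eq _ _
    _ = polarWave c d T (k * r) β := by
        rw [zero_add, intervalIntegral.integral_of_le hpi, ← integral_Icc_eq_integral_Ioc]
        rfl

lemma exists_polar_coordinates (x : R3) : ∃ φ₀ β : ℝ, 0 ≤ β ∧ (0 < x 2 → β ≤ Real.pi / 2) ∧
    x 0 = ‖x‖ * Real.sin β * Real.cos φ₀ ∧ x 1 = ‖x‖ * Real.sin β * Real.sin φ₀ ∧
    x 2 = ‖x‖ * Real.cos β := by
  set z : ℂ := ⟨x 0, x 1⟩ with hz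
  set w : ℂ := ⟨x 2, ‖z‖⟩ with hw
  have hzn : ‖z‖ ^ 2 = x 0 ^ 2 + x 1 ^ 2 := by
    rw [Complex.sq_norm, Complex.normSq_mk]
    ring
  have hwn : ‖w‖ = ‖x‖ := by
    rw [← sq_eq_sq₀ (norm_nonneg _) (norm_nonneg _), norm_eq_sqrt_three, Complex.sq_norm,
      Complex.normSq_mk]
    linarith
  have hs : ‖x‖ * Real.sin w.arg = ‖z‖ := by rw [← hwn, Complex.norm_mul_sin_arg]
  refine ⟨z.arg, w.arg, Complex.arg_nonneg_iff.2 (norm_nonneg z), fun h => ?_, ?_, ?_, ?_⟩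
  · exact (le_abs_self _).trans (Complex.abs_arg_le_pi_div_two_iff.2 h.le)
  · rw [hs, Complex.norm_mul_cos_arg]
  · rw [hs, Complex.norm_mul_sin_arg]
  · rw [← hwn, Complex.norm_mul_cos_arg]

lemma waveIntegral_sphere {k : ℝ} (hk : 0 < k) {x : R3} (hx : x ≠ 0) :
    waveIntegral 0 1 Real.pi k x =
      4 * Real.pi * (Complex.sin (k * ‖x‖ : ℝ) / (k * ‖x‖ : ℝ)) := by
  obtain ⟨φ₀, β, -, -, h0, h1, h2⟩ := exists_polar_coordinates x
  rw [waveIntegral_eq_polarWave h0 h1 h2, polarWave_zero_pi]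
  exact (mul_pos hk (norm_pos_iff.2 hx)).ne'

/-- Truncated Weyl representation of the outgoing spherical wave in the upper half space. -/
lemma norm_waveIntegral_weyl_sub_le {k : ℝ} (hk : 0 < k) {T : ℝ} (hT : 0 ≤ T) {x : R3}
    (hx : 1 ≤ x 2) :
    ‖waveIntegral 0 1 (Real.pi / 2) k x + waveIntegral (Real.pi / 2) (-Complex.I) T k x -
      8 * Real.pi ^ 2 / (Complex.I * k) * helmholtzKernel k x‖ ≤
      2 * Real.pi * (1 / k + Real.pi * Real.cosh T) * Real.exp (-(k * Real.sinh T)) := by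
  obtain ⟨φ₀, β, hβ, hβ', h0, h1, h2⟩ := exists_polar_coordinates x
  have hβ2 := hβ' (by linarith)
  have hxn : 1 ≤ ‖x‖ := hx.trans (by
    have := PiLp.norm_apply_le x 2
    rw [Real.norm_eq_abs] at this
    exact (le_abs_self _).trans this)
  have hsinh : 0 ≤ Real.sinh T := Real.sinh_nonneg_iff.2 hT
  have hcosh := Real.cosh_pos T
  have h3 := norm_polarWave_weyl_sub_le (κ := k * ‖x‖) (by positivity) hβ hβ2 hT
  rw [waveIntegral_eq_polarWave h0 h1 h2, waveIntegral_eq_polarWave h0 h1 h2]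
  have h4 : 8 * (Real.pi : ℂ) ^ 2 / (Complex.I * k) * helmholtzKernel k x =
      2 * Real.pi * (Complex.exp (Complex.I * (k * ‖x‖ : ℝ)) / (Complex.I * (k * ‖x‖ : ℝ))) := by
    have hk' : (k : ℂ) ≠ 0 := by exact_mod_cast hk.ne'
    have hx' : (‖x‖ : ℂ) ≠ 0 := by exact_mod_cast (by positivity : ‖x‖ ≠ 0)
    have hp : (Real.pi : ℂ) ≠ 0 := by exact_mod_cast Real.pi_pos.ne'
    rw [helmholtzKernel]
    push_cast
    rw [← mul_assoc]
    field_simp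
    ring
  rw [h4]
  refine h3.trans ?_
  have h5 : Real.exp (-(k * ‖x‖ * Real.sinh T)) / (k * ‖x‖) ≤
      Real.exp (-(k * Real.sinh T)) * (1 / k) := by
    rw [← div_eq_mul_one_div]
    gcongr
    · exact le_mul_of_one_le_right hk.le hxn
    · exact le_mul_of_one_le_right hk.le hxn
  have h6 : Real.exp (-(k * ‖x‖ * Real.cos β * Real.sinh T)) ≤ Real.exp (-(k * Real.sinh T)) := by
    gcongr
    rw [mul_assoc, ← h2]
    exact le_mul_of_one_le_right hk.le hx
  calc _ ≤ 2 * Real.pi * (Real.exp (-(k * Real.sinh T)) * (1 / k)) +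
        2 * Real.pi * (Real.cosh T * Real.exp (-(k * Real.sinh T))) * Real.pi := by
        have : β ≤ Real.pi := by linarith [Real.pi_pos]
        gcongr
    _ = _ := by ring

lemma tendsto_weyl_error {k : ℝ} (hk : 0 < k) :
    Filter.Tendsto (fun T => 2 * Real.pi * (1 / k + Real.pi * Real.cosh T) *
      Real.exp (-(k * Real.sinh T))) Filter.atTop (𝓝 0) := by
  have hsinh : Filter.Tendsto (fun T => k * Real.sinh T) Filter.atTop Filter.atTop :=
    (Filter.tendsto_atTop_mono' _ (Filter.eventually_ge_atTop 0 |>.mono fun T hT =>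
      Real.self_le_sinh_iff.2 hT) Filter.tendsto_id).const_mul_atTop hk
  have h1 : Filter.Tendsto (fun s : ℝ => 2 * Real.pi * (1 / k + Real.pi) * (s ^ 0 * Real.exp (-s)) +
      2 * Real.pi ^ 2 / k * (s ^ 1 * Real.exp (-s))) Filter.atTop (𝓝 0) := by
    have := ((Real.tendsto_pow_mul_exp_neg_atTop_nhds_zero 0).const_mul
      (2 * Real.pi * (1 / k + Real.pi))).add
        ((Real.tendsto_pow_mul_exp_neg_atTop_nhds_zero 1).const_mul (2 * Real.pi ^ 2 / k))
    simpa only [mul_zero, add_zero] using this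
  refine squeeze_zero' (Filter.Eventually.of_forall fun T => ?_) ?_ (h1.comp hsinh)
  · have := Real.cosh_pos T
    positivity
  · filter_upwards [Filter.eventually_ge_atTop 0] with T hT
    have h2 : Real.cosh T ≤ 1 + Real.sinh T := by
      have := Real.cosh_sub_sinh T
      have : Real.exp (-T) ≤ 1 := Real.exp_le_one_iff.2 (by linarith)
      linarith
    calc _ ≤ 2 * Real.pi * (1 / k + Real.pi * (1 + Real.sinh T)) *
          Real.exp (-(k * Real.sinh T)) := by
          have := Real.pi_pos
          gcongr
      _ = _ := by
          simp only [Function.comp]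
          field_simp
          ring

/-! ### The energy identity and Rellich's lemma -/

/-- Fourier transform of `f` on the complex sphere of radius `k`. -/
def planeTransform (k : ℝ) (f : R3 → ℂ) (α : ℂ) (φ : ℝ) : ℂ := ∫ y, f y * planeWave k α φ (-y)

lemma integral_eq_setIntegral_tsupport (f h : R3 → ℂ) :
    ∫ y, f y * h y = ∫ y in tsupport f, f y * h y :=
  (setIntegral_eq_integral_of_forall_compl_eq_zero fun y hy => by
    rw [image_eq_zero_of_notMem_tsupport hy, zero_mul]).symm

lemma integral_mul_setIntegral_setIntegral {f : R3 → ℂ} (hf : Continuous f)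
    (hc : HasCompactSupport f) {H : R3 → ℝ → ℝ → ℂ}
    (hH : Continuous fun p : R3 × ℝ × ℝ => H p.1 p.2.1 p.2.2) {K L : Set ℝ} (hK : IsCompact K)
    (hL : IsCompact L) :
    ∫ y, f y * ∫ s in K, ∫ t in L, H y s t = ∫ s in K, ∫ t in L, ∫ y, f y * H y s t := by
  have hH1 : Continuous fun q : R3 × ℝ => ∫ t in L, H q.1 q.2 t :=
    continuous_parametric_integral_of_continuous (f := fun (q : R3 × ℝ) (t : ℝ) => H q.1 q.2 t)
      (hH.comp (by fun_prop : Continuous fun q : (R3 × ℝ) × ℝ => (q.1.1, q.1.2, q.2))) hL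
  calc ∫ y, f y * ∫ s in K, ∫ t in L, H y s t
      = ∫ y in tsupport f, ∫ s in K, f y * ∫ t in L, H y s t := by
        rw [integral_eq_setIntegral_tsupport]
        simp only [integral_const_mul]
    _ = ∫ s in K, ∫ y in tsupport f, f y * ∫ t in L, H y s t :=
        setIntegral_setIntegral_swap (f := fun y s => f y * ∫ t in L, H y s t)
          ((hf.comp continuous_fst).mul hH1) hc.isCompact hK
    _ = ∫ s in K, ∫ t in L, ∫ y in tsupport f, f y * H y s t := by
        congr 1; funext s
        simp only [← integral_const_mul]
        exact setIntegral_setIntegral_swap (f := fun y t => f y * H y s t)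
          ((hf.comp continuous_fst).mul
            (hH.comp (by fun_prop : Continuous fun q : R3 × ℝ => (q.1, s, q.2)))) hc.isCompact hL
    _ = _ := by simp only [← integral_eq_setIntegral_tsupport]

lemma integral_mul_waveIntegral {f : R3 → ℂ} (hf : Continuous f)
    (hc : HasCompactSupport f) (c d : ℂ) (T k : ℝ) (x : R3) :
    ∫ y, f y * waveIntegral c d T k (x - y) =
      ∫ φ in Set.Icc 0 (2 * Real.pi), ∫ τ in Set.Icc 0 T, planeTransform k f (c + d * (τ : ℂ)) φ *
        (planeWave k (c + d * (τ : ℂ)) φ x * (d * Complex.sin (c + d * (τ : ℂ)))) := by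
  simp only [waveIntegral]
  rw [integral_mul_setIntegral_setIntegral hf hc (H := fun y φ τ =>
    planeWave k (c + d * (τ : ℂ)) φ (x - y) * (d * Complex.sin (c + d * (τ : ℂ)))) _ isCompact_Icc
      isCompact_Icc]
  · simp only [planeTransform, ← integral_mul_const]
    congr 1; funext φ; congr 1; funext τ; congr 1; funext y
    rw [planeWave_sub]
    ring
  · simp only [planeWave]
    fun_prop

lemma continuous_planeTransform (k : ℝ) {f : R3 → ℂ} (hf : Continuous f)
    (hc : HasCompactSupport f) :
    Continuous fun p : ℂ × ℝ => planeTransform k f p.1 p.2 := by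
  simp only [planeTransform, integral_eq_setIntegral_tsupport]
  refine continuous_parametric_integral_of_continuous
    (f := fun (p : ℂ × ℝ) (y : R3) => f y * planeWave k p.1 p.2 (-y)) ?_ hc.isCompact
  simp only [planeWave, Function.uncurry_def]
  fun_prop

lemma differentiable_planeTransform (k : ℝ) {f : R3 → ℂ} (hf : Continuous f)
    (hc : HasCompactSupport f) (φ : ℝ) : Differentiable ℂ fun α => planeTransform k f α φ := by
  intro α
  simp only [planeTransform, integral_eq_setIntegral_tsupport]
  refine (hasDerivAt_setIntegral (𝕜 := ℂ) (f := fun α y => f y * planeWave k α φ (-y))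
    (f' := fun α y => f y * (planeWave k α φ (-y) * (Complex.I * k * (Complex.cos α *
      ((-y) 0 * Complex.cos φ + (-y) 1 * Complex.sin φ) + -Complex.sin α * (-y) 2))))
    ?_ ?_ (fun α y => ?_) hc.isCompact α).differentiableAt
  · simp only [planeWave, Function.uncurry_def]
    fun_prop
  · simp only [planeWave, Function.uncurry_def]
    fun_prop
  · exact (((((Complex.hasDerivAt_sin α).mul_const _).add
      ((Complex.hasDerivAt_cos α).mul_const _)).const_mul _).cexp).const_mul _

lemma conj_planeWave (k : ℝ) (τ φ : ℝ) (x : R3) :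
    (starRingEnd ℂ) (planeWave k τ φ (-x)) = planeWave k τ φ x := by
  rw [planeWave, planeWave, ← Complex.exp_conj]
  congr 1
  simp only [← Complex.ofReal_sin, ← Complex.ofReal_cos, map_mul, map_add, map_neg, Complex.conj_I,
    Complex.conj_ofReal, PiLp.neg_apply, Complex.ofReal_neg]
  ring

lemma integral_conj_mul_planeWave (k : ℝ) (f : R3 → ℂ) (τ φ : ℝ) :
    ∫ x, (starRingEnd ℂ) (f x) * planeWave k τ φ x = (starRingEnd ℂ) (planeTransform k f τ φ) := by
  rw [planeTransform, ← integral_conj]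
  simp only [map_mul, conj_planeWave]

lemma conj_g (k : ℝ) (x y : R3) : (starRingEnd ℂ) (g k x y) = g (-k) x y := by
  rw [g, g, map_div₀, ← Complex.exp_conj]
  simp only [map_mul, Complex.conj_I, Complex.conj_ofReal, map_ofNat, Complex.ofReal_neg]
  congr 2
  ring

lemma conj_volumePotential (k : ℝ) (f : R3 → ℂ) (x : R3) :
    (starRingEnd ℂ) (volumePotential k f x) =
      volumePotential (-k) (fun y => (starRingEnd ℂ) (f y)) x := by
  rw [volumePotential, volumePotential, ← integral_conj]
  simp only [map_mul, conj_g]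

lemma g_sub_g_neg {k : ℝ} (hk : 0 < k) {x y : R3} (h : y ≠ x) :
    g k x y - g (-k) x y =
      Complex.I * k / (8 * Real.pi ^ 2) * waveIntegral 0 1 Real.pi k (x - y) := by
  have h0 : x - y ≠ 0 := sub_ne_zero.2 h.symm
  rw [waveIntegral_sphere hk h0, g, g, Complex.sin]
  have hk' : (k : ℂ) ≠ 0 := by exact_mod_cast hk.ne'
  have hx' : (‖x - y‖ : ℂ) ≠ 0 := by exact_mod_cast (norm_pos_iff.2 h0).ne'
  have hp : (Real.pi : ℂ) ≠ 0 := by exact_mod_cast Real.pi_pos.ne'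
  have e1 : Complex.I * ((-k : ℝ) : ℂ) * (‖x - y‖ : ℝ) = -((k * ‖x - y‖ : ℝ) : ℂ) * Complex.I := by
    push_cast; ring
  have e2 : Complex.I * (k : ℂ) * (‖x - y‖ : ℝ) = ((k * ‖x - y‖ : ℝ) : ℂ) * Complex.I := by
    push_cast; ring
  rw [e1, e2]
  push_cast
  field_simp
  rw [Complex.I_sq]
  ring

lemma volumePotential_sub_neg {k : ℝ} (hk : 0 < k) {f : R3 → ℂ} (hf : Continuous f)
    (hc : HasCompactSupport f) (x : R3) :
    volumePotential k f x - volumePotential (-k) f x =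
      Complex.I * k / (8 * Real.pi ^ 2) * ∫ φ in Set.Icc 0 (2 * Real.pi),
        ∫ τ in Set.Icc 0 Real.pi, planeTransform k f τ φ *
          (planeWave k τ φ x * Complex.sin τ) := by
  have h1 := integral_mul_waveIntegral hf hc 0 1 Real.pi k x
  simp only [zero_add, one_mul] at h1
  rw [← h1, volumePotential, volumePotential,
    ← integral_sub (hc.integrable_g_mul hf x) (hc.integrable_g_mul hf x), ← integral_const_mul]
  have hne : ∀ᵐ y : R3, y ≠ x := by
    simp [ae_iff]
  refine integral_congr_ae ?_
  filter_upwards [hne] with y hy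
  rw [← sub_mul, g_sub_g_neg hk hy]
  ring

/-- Energy identity for volume potentials. -/
lemma im_integral_conj_mul_volumePotential {k : ℝ} (hk : 0 < k) {f : R3 → ℂ} (hf : Continuous f)
    (hc : HasCompactSupport f) :
    (∫ x, (starRingEnd ℂ) (f x) * volumePotential k f x).im =
      k / (16 * Real.pi ^ 2) * ∫ φ in Set.Icc 0 (2 * Real.pi),
        ∫ τ in Set.Icc 0 Real.pi, ‖planeTransform k f τ φ‖ ^ 2 * Real.sin τ := by
  set fc : R3 → ℂ := fun x => (starRingEnd ℂ) (f x) with hfc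
  have hfc1 : Continuous fc := Complex.continuous_conj.comp hf
  have hfc2 : HasCompactSupport fc := hc.comp_left (g := starRingEnd ℂ) (map_zero _)
  set Q := ∫ x, fc x * volumePotential k f x with hQ
  have hconj : (starRingEnd ℂ) Q = ∫ x, fc x * volumePotential (-k) f x := by
    rw [hQ, ← integral_conj]
    simp only [map_mul, conj_volumePotential, hfc, Complex.conj_conj]
    rw [← hfc, integral_mul_volumePotential hf hc hfc1 hfc2]
    simp only [hfc, mul_comm]
  have hi : ∀ κ : ℝ, Integrable fun x => fc x * volumePotential κ f x := fun κ =>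
    (hfc1.mul (hc.continuous_volumePotential hf)).integrable_of_hasCompactSupport hfc2.mul_right
  have hcont : Continuous fun p : R3 × ℝ × ℝ => planeTransform k f p.2.2 p.2.1 *
      (planeWave k p.2.2 p.2.1 p.1 * Complex.sin p.2.2) := by
    refine ((continuous_planeTransform k hf hc).comp
      (by fun_prop : Continuous fun p : R3 × ℝ × ℝ => ((p.2.2 : ℂ), p.2.1))).mul ?_
    simp only [planeWave]
    fun_prop
  have hsub : Q - (starRingEnd ℂ) Q = Complex.I * k / (8 * Real.pi ^ 2) *
      ∫ φ in Set.Icc 0 (2 * Real.pi), ∫ τ in Set.Icc 0 Real.pi,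
        ((‖planeTransform k f τ φ‖ ^ 2 * Real.sin τ : ℝ) : ℂ) := by
    rw [hconj, hQ, ← integral_sub (hi k) (hi (-k))]
    simp only [← mul_sub, volumePotential_sub_neg hk hf hc]
    simp only [mul_left_comm (fc _), integral_const_mul]
    rw [integral_mul_setIntegral_setIntegral hfc1 hfc2 hcont isCompact_Icc isCompact_Icc]
    congr 2; funext φ; congr 1; funext τ
    have h1 := integral_conj_mul_planeWave k f τ φ
    calc ∫ y, fc y * (planeTransform k f τ φ * (planeWave k τ φ y * Complex.sin τ))
        = (planeTransform k f τ φ * Complex.sin τ) * ∫ y, fc y * planeWave k τ φ y := by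
          rw [← integral_const_mul]
          congr 1; funext y; ring
      _ = _ := by
          rw [h1]
          push_cast
          rw [← Complex.mul_conj']
          ring
  have h2 : ∫ φ in Set.Icc 0 (2 * Real.pi), ∫ τ in Set.Icc 0 Real.pi,
        ((‖planeTransform k f τ φ‖ ^ 2 * Real.sin τ : ℝ) : ℂ) =
      ((∫ φ in Set.Icc 0 (2 * Real.pi), ∫ τ in Set.Icc 0 Real.pi,
        ‖planeTransform k f τ φ‖ ^ 2 * Real.sin τ : ℝ) : ℂ) := by
    rw [← integral_complex_ofReal]
    congr 1; funext φ
    exact integral_complex_ofReal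
  rw [h2] at hsub
  have h3 := congrArg Complex.im hsub
  set J := ∫ φ in Set.Icc 0 (2 * Real.pi), ∫ τ in Set.Icc 0 Real.pi,
        ‖planeTransform k f τ φ‖ ^ 2 * Real.sin τ
  have h4 : Complex.I * (k : ℂ) / (8 * Real.pi ^ 2) * J =
      ((k / (8 * Real.pi ^ 2) * J : ℝ) : ℂ) * Complex.I := by
    push_cast; ring
  rw [h4, Complex.sub_im, Complex.conj_im, Complex.im_ofReal_mul, Complex.I_im] at h3
  have h5 : k / (8 * Real.pi ^ 2) * J = 2 * (k / (16 * Real.pi ^ 2) * J) := by ring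
  linarith

lemma eq_zero_of_setIntegral_Icc_eq_zero {a b : ℝ} (hab : a < b) {F : ℝ → ℝ} (hF : Continuous F)
    (h0 : ∀ x ∈ Set.Icc a b, 0 ≤ F x) (h : ∫ x in Set.Icc a b, F x = 0) {x : ℝ}
    (hx : x ∈ Set.Icc a b) : F x = 0 := by
  rw [setIntegral_eq_zero_iff_of_nonneg_ae
    ((ae_restrict_iff' measurableSet_Icc).2 (Filter.Eventually.of_forall h0))
    (hF.continuousOn.integrableOn_Icc)] at h
  exact Measure.eqOn_Icc_of_ae_eq volume hab.ne h hF.continuousOn continuousOn_const hx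

lemma continuous_energy_density (k : ℝ) {f : R3 → ℂ} (hf : Continuous f)
    (hc : HasCompactSupport f) :
    Continuous fun p : ℝ × ℝ => ‖planeTransform k f p.2 p.1‖ ^ 2 * Real.sin p.2 :=
  (((continuous_planeTransform k hf hc).comp
      (by fun_prop : Continuous fun p : ℝ × ℝ => ((p.2 : ℂ), p.1))).norm.pow 2).mul
    (by fun_prop)

lemma energy_density_nonneg (k : ℝ) (f : R3 → ℂ) (φ : ℝ) {τ : ℝ} (hτ : τ ∈ Set.Icc 0 Real.pi) :
    0 ≤ ‖planeTransform k f τ φ‖ ^ 2 * Real.sin τ :=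
  mul_nonneg (by positivity) (Real.sin_nonneg_of_mem_Icc hτ)

lemma im_integral_conj_mul_volumePotential_nonneg {k : ℝ} (hk : 0 < k) {f : R3 → ℂ}
    (hf : Continuous f) (hc : HasCompactSupport f) :
    0 ≤ (∫ x, (starRingEnd ℂ) (f x) * volumePotential k f x).im := by
  rw [im_integral_conj_mul_volumePotential hk hf hc]
  refine mul_nonneg (by positivity) (setIntegral_nonneg measurableSet_Icc fun φ _ =>
    setIntegral_nonneg measurableSet_Icc fun τ hτ => energy_density_nonneg k f φ hτ)

lemma planeTransform_eq_zero {k : ℝ} (hk : 0 < k) {f : R3 → ℂ} (hf : Continuous f)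
    (hc : HasCompactSupport f)
    (him : (∫ x, (starRingEnd ℂ) (f x) * volumePotential k f x).im ≤ 0) (α : ℂ) {φ : ℝ}
    (hφ : φ ∈ Set.Icc 0 (2 * Real.pi)) : planeTransform k f α φ = 0 := by
  have hJ := le_antisymm him (im_integral_conj_mul_volumePotential_nonneg hk hf hc)
  rw [im_integral_conj_mul_volumePotential hk hf hc] at hJ
  have hcont := continuous_energy_density k hf hc
  have h1 := eq_zero_of_setIntegral_Icc_eq_zero Real.two_pi_pos
    (continuous_parametric_integral_of_continuous
      (f := fun φ τ : ℝ => ‖planeTransform k f τ φ‖ ^ 2 * Real.sin τ) hcont isCompact_Icc)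
    (fun φ _ => setIntegral_nonneg measurableSet_Icc fun τ hτ => energy_density_nonneg k f φ hτ)
    ((mul_eq_zero.1 hJ).resolve_left (by positivity)) hφ
  have h2 : ∀ τ ∈ Set.Ioo 0 Real.pi, planeTransform k f τ φ = 0 := fun τ hτ => by
    have h3 := eq_zero_of_setIntegral_Icc_eq_zero Real.pi_pos
      (hcont.comp (by fun_prop : Continuous fun τ : ℝ => (φ, τ)))
      (fun τ hτ => energy_density_nonneg k f φ hτ) h1 (Set.Ioo_subset_Icc_self hτ)
    have h4 := (mul_eq_zero.1 h3).resolve_right (Real.sin_pos_of_mem_Ioo hτ).ne'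
    simpa using h4
  have han : AnalyticOnNhd ℂ (fun α => planeTransform k f α φ) Set.univ :=
    fun z _ => (differentiable_planeTransform k hf hc φ).analyticAt z
  refine han.eqOn_zero_of_preconnected_of_frequently_eq_zero isPreconnected_univ
    (z₀ := ((1 : ℝ) : ℂ)) (Set.mem_univ _) ?_ (Set.mem_univ α)
  have ht : Filter.Tendsto (fun t : ℝ => (t : ℂ)) (𝓝[≠] 1) (𝓝[≠] ((1 : ℝ) : ℂ)) := by
    refine tendsto_nhdsWithin_iff.2 ⟨(Complex.continuous_ofReal.tendsto 1).mono_left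
      nhdsWithin_le_nhds, ?_⟩
    filter_upwards [self_mem_nhdsWithin] with t ht
    simpa using ht
  have h5 : ∀ᶠ t : ℝ in 𝓝[≠] 1, planeTransform k f (t : ℂ) φ = 0 :=
    nhdsWithin_le_nhds (Filter.mem_of_superset
      (isOpen_Ioo.mem_nhds ⟨one_pos, by linarith [Real.pi_gt_three]⟩) h2)
  exact ht.frequently h5.frequently

lemma volumePotential_eq_zero_of_one_le {k : ℝ} (hk : 0 < k) {f : R3 → ℂ} (hf : Continuous f)
    (hc : HasCompactSupport f)
    (him : (∫ x, (starRingEnd ℂ) (f x) * volumePotential k f x).im ≤ 0) {x : R3}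
    (hx : ∀ y, f y ≠ 0 → 1 ≤ x 2 - y 2) : volumePotential k f x = 0 := by
  have hz : ∀ (c d : ℂ) (T : ℝ), ∫ y, f y * waveIntegral c d T k (x - y) = 0 := fun c d T => by
    rw [integral_mul_waveIntegral hf hc]
    refine setIntegral_eq_zero_of_forall_eq_zero fun φ hφ =>
      setIntegral_eq_zero_of_forall_eq_zero fun τ _ => ?_
    rw [planeTransform_eq_zero hk hf hc him _ hφ, zero_mul]
  have hwc : ∀ (c d : ℂ) (T : ℝ), Continuous fun y => waveIntegral c d T k (x - y) := by
    intro c d T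
    have h1 : Continuous fun p : (R3 × ℝ) × ℝ => planeWave k (c + d * (p.2 : ℂ)) p.1.2 (x - p.1.1) *
        (d * Complex.sin (c + d * (p.2 : ℂ))) := by
      simp only [planeWave]
      fun_prop
    exact continuous_parametric_integral_of_continuous (f := fun (y : R3) (φ : ℝ) =>
      ∫ τ in Set.Icc 0 T, planeWave k (c + d * (τ : ℂ)) φ (x - y) *
        (d * Complex.sin (c + d * (τ : ℂ))))
      (continuous_parametric_integral_of_continuous (f := fun (p : R3 × ℝ) (τ : ℝ) =>
        planeWave k (c + d * (τ : ℂ)) p.2 (x - p.1) * (d * Complex.sin (c + d * (τ : ℂ))))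
        h1 isCompact_Icc) isCompact_Icc
  have hwi : ∀ (c d : ℂ) (T : ℝ), Integrable fun y => f y * waveIntegral c d T k (x - y) :=
    fun c d T => (hf.mul (hwc c d T)).integrable_of_hasCompactSupport hc.mul_right
  have hVi := (hc.integrable_g_mul (k := k) hf x).const_mul (8 * Real.pi ^ 2 / (Complex.I * k))
  set ε : ℝ → ℝ := fun T => 2 * Real.pi * (1 / k + Real.pi * Real.cosh T) *
    Real.exp (-(k * Real.sinh T)) with hε
  have hbound : ∀ T : ℝ, 0 ≤ T → ‖8 * Real.pi ^ 2 / (Complex.I * k) * volumePotential k f x‖ ≤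
      ε T * ∫ y, ‖f y‖ := by
    intro T hT
    have e1 : -(8 * Real.pi ^ 2 / (Complex.I * k) * volumePotential k f x) =
        ∫ y, f y * (waveIntegral 0 1 (Real.pi / 2) k (x - y) +
          waveIntegral (Real.pi / 2) (-Complex.I) T k (x - y) -
          8 * Real.pi ^ 2 / (Complex.I * k) * helmholtzKernel k (x - y)) := by
      calc -(8 * Real.pi ^ 2 / (Complex.I * k) * volumePotential k f x)
          = (∫ y, f y * waveIntegral 0 1 (Real.pi / 2) k (x - y)) +
            (∫ y, f y * waveIntegral (Real.pi / 2) (-Complex.I) T k (x - y)) -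
            ∫ y, 8 * Real.pi ^ 2 / (Complex.I * k) * (g k x y * f y) := by
            rw [hz, hz, integral_const_mul, volumePotential]
            ring
        _ = _ := by
            rw [← integral_add (hwi _ _ _) (hwi _ _ _)]
            refine (integral_sub ((hwi _ _ _).add (hwi _ _ _)) hVi).symm.trans ?_
            congr 1; funext y
            rw [g_eq_helmholtzKernel, Pi.add_apply]
            ring
    rw [← norm_neg, e1, ← integral_const_mul]
    refine norm_integral_le_of_norm_le
      ((hf.norm.integrable_of_hasCompactSupport hc.norm).const_mul _)
      (Filter.Eventually.of_forall fun y => ?_)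
    by_cases hy : f y = 0
    · simp [hy]
    · rw [norm_mul, mul_comm]
      exact mul_le_mul_of_nonneg_right
        (norm_waveIntegral_weyl_sub_le hk hT (by simpa using hx y hy)) (norm_nonneg _)
  have hlim := (tendsto_weyl_error hk).mul_const (∫ y, ‖f y‖)
  rw [zero_mul] at hlim
  have h0 := ge_of_tendsto hlim (Filter.eventually_atTop.2 ⟨0, hbound⟩)
  have h1 := norm_le_zero_iff.1 h0
  refine (mul_eq_zero.1 h1).resolve_left ?_
  have hp : (Real.pi : ℂ) ≠ 0 := by exact_mod_cast Real.pi_pos.ne'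
  have hk' : (k : ℂ) ≠ 0 := by exact_mod_cast hk.ne'
  simp [hp, hk', Complex.I_ne_zero]

lemma integral_comp_linearIsometryEquiv (L : R3 ≃ₗᵢ[ℝ] R3) (f : R3 → ℂ) :
    ∫ y, f (L y) = ∫ y, f y :=
  MeasurePreserving.integral_comp (μ := volume) (ν := volume) L.measurePreserving
    L.toHomeomorph.measurableEmbedding f

lemma volumePotential_comp_isometry (k : ℝ) (f : R3 → ℂ) (L : R3 ≃ₗᵢ[ℝ] R3) (x : R3) :
    volumePotential k (fun y => f (L y)) x = volumePotential k f (L x) := by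
  rw [volumePotential, volumePotential]
  calc ∫ y, g k x y * f (L y) = ∫ y, (fun z => g k (L x) z * f z) (L y) := by
        congr 1; funext y
        simp only [g, ← map_sub, L.norm_map]
    _ = _ := integral_comp_linearIsometryEquiv L fun z => g k (L x) z * f z

/-- Rellich-type lemma: a source radiating no energy produces no field far away. -/
lemma volumePotential_eq_zero_of_im_nonpos {k : ℝ} (hk : 0 < k) {f : R3 → ℂ} (hf : Continuous f)
    (hc : HasCompactSupport f)
    (him : (∫ x, (starRingEnd ℂ) (f x) * volumePotential k f x).im ≤ 0) {R : ℝ}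
    (hR : ∀ y, f y ≠ 0 → ‖y‖ ≤ R) {x : R3} (hx : R + 1 ≤ ‖x‖) : volumePotential k f x = 0 := by
  set e : R3 := EuclideanSpace.single 2 ‖x‖ with he
  have hne : ‖e‖ = ‖x‖ := by simp [he]
  set L : R3 ≃ₗᵢ[ℝ] R3 := (ℝ ∙ (e - x))ᗮ.reflection with hL
  have hLe : L e = x := Submodule.reflection_sub hne
  rw [← hLe, ← volumePotential_comp_isometry]
  refine volumePotential_eq_zero_of_one_le hk (hf.comp L.continuous)
    (hc.comp_homeomorph L.toHomeomorph) ?_ fun y hy => ?_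
  · calc (∫ y, (starRingEnd ℂ) (f (L y)) * volumePotential k (fun z => f (L z)) y).im
        = (∫ y, (fun z => (starRingEnd ℂ) (f z) * volumePotential k f z) (L y)).im := by
          simp only [volumePotential_comp_isometry]
      _ = (∫ x, (starRingEnd ℂ) (f x) * volumePotential k f x).im := by
          rw [integral_comp_linearIsometryEquiv L
            fun z => (starRingEnd ℂ) (f z) * volumePotential k f z]
      _ ≤ 0 := him
  · have h1 := hR _ hy
    rw [L.norm_map] at h1
    have h2 := (le_abs_self (y 2)).trans (PiLp.norm_apply_le y 2)
    have h3 : e 2 = ‖x‖ := by simp [he]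
    rw [h3]
    linarith

lemma hasCompactSupport_volumePotential {k : ℝ} (hk : 0 < k) {f : R3 → ℂ} (hf : Continuous f)
    (hc : HasCompactSupport f)
    (him : (∫ x, (starRingEnd ℂ) (f x) * volumePotential k f x).im ≤ 0) :
    HasCompactSupport (volumePotential k f) := by
  obtain ⟨R, hR⟩ := hc.isCompact.isBounded.exists_norm_le
  refine HasCompactSupport.intro (isCompact_closedBall (0 : R3) (R + 1)) fun x hx => ?_
  rw [mem_closedBall_zero_iff, not_le] at hx
  exact volumePotential_eq_zero_of_im_nonpos hk hf hc him
    (fun y hy => hR y (subset_tsupport f hy)) hx.le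

/-! ### The integral equation -/

lemma contDiff_two_of_contDiff_pd {f : R3 → ℂ} (hf : ContDiff ℝ 1 f)
    (h : ∀ i, ContDiff ℝ 1 (pd i f)) : ContDiff ℝ 2 f := by
  have h1 : fderiv ℝ f = fun x =>
      ∑ i, (EuclideanSpace.proj i : R3 →L[ℝ] ℝ).smulRight (pd i f x) := by
    funext x
    ext v
    have hv : v = ∑ i, v i • EuclideanSpace.single i (1 : ℝ) := by
      ext j
      simp [Finset.sum_apply, Pi.single_apply]
    rw [sum_apply]
    conv_lhs => rw [hv, map_sum]
    refine Finset.sum_congr rfl fun i _ => ?_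
    rw [map_smul]
    rfl
  rw [show (2 : WithTop ℕ∞) = 1 + 1 from one_add_one_eq_two.symm, contDiff_succ_iff_fderiv]
  refine ⟨hf.differentiable one_ne_zero, by simp, ?_⟩
  rw [h1]
  exact ContDiff.sum fun i _ => contDiff_const.smulRight (h i)

lemma im_integral_conj_mul_mul_nonpos {p ψ : R3 → ℂ} (hp : Continuous p)
    (hpc : HasCompactSupport p) (him : ∀ x, 0 ≤ (p x).im) (hψ : Continuous ψ) :
    (∫ x, (starRingEnd ℂ) (p x * ψ x) * ψ x).im ≤ 0 := by
  have hi : Integrable fun x => (starRingEnd ℂ) (p x * ψ x) * ψ x := by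
    refine ((Complex.continuous_conj.comp (hp.mul hψ)).mul hψ).integrable_of_hasCompactSupport ?_
    exact ((hpc.mul_right (f' := ψ)).comp_left (g := starRingEnd ℂ) (map_zero _)).mul_right
  have h1 := Complex.imCLM.integral_comp_comm hi
  simp only [Complex.imCLM_apply] at h1
  rw [← h1]
  refine integral_nonpos fun x => ?_
  have h2 : (starRingEnd ℂ) (p x * ψ x) * ψ x =
      (starRingEnd ℂ) (p x) * ((‖ψ x‖ ^ 2 : ℝ) : ℂ) := by
    push_cast
    rw [← Complex.conj_mul', map_mul]
    ring
  simp only [h2, Complex.im_mul_ofReal, Complex.conj_im, Pi.zero_apply]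
  have h3 := mul_nonneg (him x) (sq_nonneg ‖ψ x‖)
  linarith

lemma eq_zero_of_eq_volumePotential_mul {k : ℝ} (hk : 0 < k) {p ψ : R3 → ℂ} (hp : Continuous p)
    (hpc : HasCompactSupport p) (him : ∀ x, 0 ≤ (p x).im) (hψ : Continuous ψ)
    (h : ∀ x, ψ x = volumePotential k (fun y => p y * ψ y) x) (x : R3) : ψ x = 0 := by
  have hf : Continuous fun y => p y * ψ y := hp.mul hψ
  have hfc : HasCompactSupport fun y => p y * ψ y := hpc.mul_right
  have hV : volumePotential k (fun y => p y * ψ y) = ψ := (funext h).symm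
  have hψc : HasCompactSupport ψ := by
    rw [← hV]
    refine hasCompactSupport_volumePotential hk hf hfc ?_
    rw [hV]
    exact im_integral_conj_mul_mul_nonpos hp hpc him hψ
  obtain ⟨C, hC⟩ := hpc.exists_bound_of_continuous hp
  have hw : ∀ φ : R3 → ℂ, ContDiff ℝ 2 φ → HasCompactSupport φ →
      ∫ y, ψ y * laplace φ y = ∫ y, (-((k : ℂ) ^ 2 + p y) * ψ y) * φ y := by
    intro φ hφ hφc
    have h1 := integral_volumePotential_mul_laplace (k := k) hf hfc hφ hφc
    rw [hV] at h1
    have i1 : Integrable fun y => ψ y * (laplace φ y + (k : ℂ) ^ 2 * φ y) :=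
      (hψ.mul (hφ.continuous_laplace.add
        (continuous_const.mul hφ.continuous))).integrable_of_hasCompactSupport hψc.mul_right
    have i2 : Integrable fun y => (k : ℂ) ^ 2 * (ψ y * φ y) :=
      ((hψ.mul hφ.continuous).integrable_of_hasCompactSupport hψc.mul_right).const_mul _
    have i3 : Integrable fun y => p y * ψ y * φ y :=
      (hf.mul hφ.continuous).integrable_of_hasCompactSupport hfc.mul_right
    calc ∫ y, ψ y * laplace φ y
        = ∫ y, (ψ y * (laplace φ y + (k : ℂ) ^ 2 * φ y) - (k : ℂ) ^ 2 * (ψ y * φ y)) := by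
          congr 1; funext y; ring
      _ = -(∫ y, p y * ψ y * φ y) - ∫ y, (k : ℂ) ^ 2 * (ψ y * φ y) := by
          rw [integral_sub i1 i2, h1]
      _ = ∫ y, (-(p y * ψ y * φ y) - (k : ℂ) ^ 2 * (ψ y * φ y)) := by
          rw [← integral_neg]
          exact (integral_sub i3.neg i2).symm
      _ = _ := by congr 1; funext y; ring
  have hF : Continuous fun y => -((k : ℂ) ^ 2 + p y) * ψ y :=
    ((continuous_const.add hp).neg).mul hψ
  have hFc : HasCompactSupport fun y => -((k : ℂ) ^ 2 + p y) * ψ y := hψc.mul_left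
  have hle : ∀ y, ‖-((k : ℂ) ^ 2 + p y) * ψ y‖ ≤ (‖(k : ℂ) ^ 2‖ + C) * ‖ψ y‖ := fun y => by
    rw [norm_mul, norm_neg]
    exact mul_le_mul_of_nonneg_right ((norm_add_le _ _).trans (add_le_add le_rfl (hC y)))
      (norm_nonneg _)
  exact eq_zero_of_weak_laplace_le hψ hψc hF hFc hw hle x

section Reduction

variable {k : ℝ} {p m : R3 → ℂ} {e : Fin 3 → R3 → ℂ}

lemma divergence_eq_neg (hk : 0 < k) (hp : ContDiff ℝ 2 p) (hpc : HasCompactSupport p)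
    (him : ∀ x, 0 ≤ (p x).im) (he : ∀ i, ContDiff ℝ 2 (e i)) (hm : ContDiff ℝ 1 m)
    (hmc : HasCompactSupport m)
    (hpm : ∀ x, ∑ i, pd i p x * e i x = ((k : ℂ) ^ 2 + p x) * m x)
    (h : ∀ i x, e i x = volumePotential k (fun y => p y * e i y) x +
      pd i (volumePotential k m) x) (x : R3) : ∑ i, pd i (e i) x = -m x := by
  have hpe : ∀ i, ContDiff ℝ 2 fun y => p y * e i y := fun i => hp.mul (he i)
  have hpec : ∀ i, HasCompactSupport fun y => p y * e i y := fun i => hpc.mul_right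
  have hVpe : ∀ i, ContDiff ℝ 2 (volumePotential k fun y => p y * e i y) := fun i =>
    (hpec i).contDiff_volumePotential (n := 2) (hpe i)
  have hVm : ContDiff ℝ 1 (volumePotential k m) := hmc.contDiff_volumePotential (n := 1) hm
  have hpdV : ∀ i, pd i (volumePotential k m) =
      fun x => e i x - volumePotential k (fun y => p y * e i y) x := fun i => by
    funext x
    rw [h i x]
    ring
  have hpdV2 : ∀ i, ContDiff ℝ 2 (pd i (volumePotential k m)) := fun i => by
    rw [hpdV]
    exact (he i).sub (hVpe i)
  have hVm2 : ContDiff ℝ 2 (volumePotential k m) :=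
    contDiff_two_of_contDiff_pd hVm fun i => (hpdV2 i).of_le one_le_two
  have hlap := laplace_volumePotential hm.continuous hmc hVm2
  have hdc : Continuous fun y => ∑ i, pd i (e i) y :=
    continuous_finsetSum _ fun i _ => (he i).continuous_pd i two_ne_zero
  set ψ : R3 → ℂ := fun y => ∑ i, pd i (e i) y + m y with hψ
  have hψc : Continuous ψ := hdc.add hm.continuous
  have hdiv : ∀ y, ∑ i, pd i (fun z => p z * e i z) y = (k : ℂ) ^ 2 * m y + p y * ψ y := by
    intro y
    have h1 : ∀ i, pd i (fun z => p z * e i z) y = p y * pd i (e i) y + pd i p y * e i y := fun i =>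
      pd_mul (hp.differentiable two_ne_zero y) ((he i).differentiable two_ne_zero y) i
    simp only [h1, Finset.sum_add_distrib, hpm, ← Finset.mul_sum, hψ]
    ring
  have hψV : ∀ y, ψ y = volumePotential k (fun z => p z * ψ z) y := by
    intro y
    have h1 : ∀ i, pd i (e i) y = volumePotential k (pd i fun z => p z * e i z) y +
        pd i (pd i (volumePotential k m)) y := fun i => by
      rw [← (hpec i).pd_volumePotential ((hpe i).of_le one_le_two),
        ← pd_add ((hVpe i).differentiable two_ne_zero y)
          ((hpdV2 i).differentiable two_ne_zero y)]
      congr 1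
      funext x
      exact h i x
    have h2 : ∑ i, volumePotential k (pd i fun z => p z * e i z) y =
        (k : ℂ) ^ 2 * volumePotential k m y + volumePotential k (fun z => p z * ψ z) y := by
      have c1 : Continuous fun z => (k : ℂ) ^ 2 * m z := continuous_const.mul hm.continuous
      have c2 : Continuous fun z => p z * ψ z := hp.continuous.mul hψc
      have s1 : HasCompactSupport fun z => (k : ℂ) ^ 2 * m z := hmc.mul_left
      have s2 : HasCompactSupport fun z => p z * ψ z := hpc.mul_right
      have e1 := congrFun (volumePotential_sum (k := k) Finset.univ
        (f := fun i => pd i fun z => p z * e i z) (fun i => (hpec i).pd i)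
        (fun i => (hpe i).continuous_pd i two_ne_zero)) y
      have e2 := congrFun (volumePotential_add (k := k) s1 c1 s2 c2) y
      rw [← e1]
      simp only [hdiv]
      rw [e2, volumePotential_const_mul]
    have h3 := hlap y
    rw [laplace] at h3
    simp only [hψ, h1, Finset.sum_add_distrib, h2, h3]
    ring
  exact eq_neg_of_add_eq_zero_left
    (eq_zero_of_eq_volumePotential_mul hk hp.continuous hpc him hψc hψV x)

lemma hasCompactSupport_of_divergence_eq (hk : 0 < k) (hp : ContDiff ℝ 2 p)
    (hpc : HasCompactSupport p)
    (him : ∀ x, 0 ≤ (p x).im) (he : ∀ i, ContDiff ℝ 2 (e i)) (hm : ContDiff ℝ 1 m)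
    (hmc : HasCompactSupport m) (hdiv : ∀ x, ∑ i, pd i (e i) x = -m x)
    (h : ∀ i, e i = volumePotential k fun y => p y * e i y + pd i m y) (i : Fin 3) :
    HasCompactSupport (e i) := by
  set f : Fin 3 → R3 → ℂ := fun i y => p y * e i y + pd i m y with hf
  have hfcont : ∀ i, Continuous (f i) := fun i =>
    (hp.continuous.mul (he i).continuous).add (hm.continuous_pd i one_ne_zero)
  have hfc : ∀ i, HasCompactSupport (f i) := fun i =>
    (hpc.mul_right (f' := e i)).add (hmc.pd i)
  set mc : R3 → ℂ := fun y => (starRingEnd ℂ) (m y) with hmcdef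
  have hmc1 : ContDiff ℝ 1 mc := Complex.conjCLE.contDiff.comp hm
  have hmcc : HasCompactSupport mc := hmc.comp_left (g := starRingEnd ℂ) (map_zero _)
  have hpdmc : ∀ i y, pd i mc y = (starRingEnd ℂ) (pd i m y) := fun i y => by
    have h1 := ((Complex.conjCLE : ℂ →L[ℝ] ℂ).hasFDerivAt.comp y
      (hm.differentiable one_ne_zero y).hasFDerivAt).fderiv
    exact congrArg (fun T : R3 →L[ℝ] ℂ => T (EuclideanSpace.single i 1)) h1
  have i1 : ∀ i, Integrable fun y => (starRingEnd ℂ) (p y * e i y) * e i y := fun i =>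
    ((Complex.continuous_conj.comp (hp.continuous.mul (he i).continuous)).mul
      (he i).continuous).integrable_of_hasCompactSupport
      ((hpc.mul_right (f' := e i)).comp_left (g := starRingEnd ℂ) (map_zero _)).mul_right
  have i2 : ∀ i, Integrable fun y => e i y * pd i mc y := fun i =>
    ((he i).continuous.mul (hmc1.continuous_pd i one_ne_zero)).integrable_of_hasCompactSupport
      (hmcc.pd i).mul_left
  have i3 : ∀ i, Integrable fun y => pd i (e i) y * mc y := fun i =>
    (((he i).continuous_pd i two_ne_zero).mul hmc1.continuous).integrable_of_hasCompactSupport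
      hmcc.mul_left
  have hsplit : ∀ i, ∫ y, (starRingEnd ℂ) (f i y) * e i y =
      (∫ y, (starRingEnd ℂ) (p y * e i y) * e i y) - ∫ y, pd i (e i) y * mc y := fun i => by
    rw [sub_eq_add_neg, ← integral_mul_pd ((he i).of_le one_le_two) hmc1 hmcc i,
      ← integral_add (i1 i) (i2 i)]
    congr 1; funext y
    simp only [hf, map_add, hpdmc]
    ring
  have hsum : ∑ i, (∫ y, (starRingEnd ℂ) (f i y) * e i y).im ≤ 0 := by
    have h1 : ∑ i, ∫ y, pd i (e i) y * mc y = -((∫ y, ‖m y‖ ^ 2 : ℝ) : ℂ) := by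
      rw [← integral_finsetSum _ fun i _ => i3 i, ← integral_complex_ofReal, ← integral_neg]
      congr 1; funext y
      rw [← Finset.sum_mul, hdiv]
      push_cast
      rw [← Complex.mul_conj']
      ring
    have h2 := congrArg Complex.im h1
    rw [Complex.im_sum, Complex.neg_im, Complex.ofReal_im, neg_zero] at h2
    simp only [hsplit, Complex.sub_im, Finset.sum_sub_distrib, h2, sub_zero]
    exact Finset.sum_nonpos fun i _ =>
      im_integral_conj_mul_mul_nonpos hp.continuous hpc him (he i).continuous
  have hV : ∀ i, volumePotential k (f i) = e i := fun i => (h i).symm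
  have hnonneg : ∀ i, 0 ≤ (∫ y, (starRingEnd ℂ) (f i y) * e i y).im := fun i => by
    have h1 := im_integral_conj_mul_volumePotential_nonneg hk (hfcont i) (hfc i)
    rwa [hV] at h1
  have hi : (∫ y, (starRingEnd ℂ) (f i y) * e i y).im ≤ 0 :=
    (Finset.single_le_sum (fun j _ => hnonneg j) (Finset.mem_univ i)).trans hsum
  rw [← hV i]
  refine hasCompactSupport_volumePotential hk (hfcont i) (hfc i) ?_
  rwa [hV]

end Reduction

lemma sum_sq_le_of_norm_le {a b : Fin 3 → ℂ} {d : Fin 3 → Fin 3 → ℂ} {M : ℝ} (hM : 0 ≤ M)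
    (h : ∀ i, ‖a i‖ ≤ M * ‖b i‖ + ∑ j, (M * ‖b j‖ + M * ‖d j i‖)) :
    ∑ i, ‖a i‖ ^ 2 ≤ 147 * M ^ 2 * ∑ j, (‖b j‖ ^ 2 + ∑ i, ‖d j i‖ ^ 2) := by
  set S := ∑ j, (‖b j‖ ^ 2 + ∑ i, ‖d j i‖ ^ 2) with hS
  have hterm : ∀ j, ‖b j‖ ^ 2 + ∑ i, ‖d j i‖ ^ 2 ≤ S := fun j =>
    Finset.single_le_sum (f := fun j => ‖b j‖ ^ 2 + ∑ i, ‖d j i‖ ^ 2)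
      (fun j _ => by positivity) (Finset.mem_univ j)
  have hb : ∀ j, ‖b j‖ ≤ √S := fun j => Real.le_sqrt_of_sq_le
    ((le_add_of_nonneg_right (by positivity)).trans (hterm j))
  have hd : ∀ j i, ‖d j i‖ ≤ √S := fun j i => Real.le_sqrt_of_sq_le
    (((Finset.single_le_sum (f := fun i => ‖d j i‖ ^ 2) (fun _ _ => by positivity)
      (Finset.mem_univ i)).trans (le_add_of_nonneg_left (by positivity))).trans (hterm j))
  have hS0 : 0 ≤ S := by positivity
  have ha : ∀ i, ‖a i‖ ^ 2 ≤ 49 * M ^ 2 * S := fun i => by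
    have h1 : ‖a i‖ ≤ 7 * (M * √S) := by
      refine (h i).trans ?_
      calc M * ‖b i‖ + ∑ j, (M * ‖b j‖ + M * ‖d j i‖)
          ≤ M * √S + ∑ _j : Fin 3, (M * √S + M * √S) := by
            gcongr
            exacts [hb i, hb _, hd _ i]
        _ = 7 * (M * √S) := by
            simp only [Finset.sum_const, Finset.card_univ, Fintype.card_fin, nsmul_eq_mul]
            push_cast
            ring
    calc ‖a i‖ ^ 2 ≤ (7 * (M * √S)) ^ 2 := by gcongr
      _ = 49 * M ^ 2 * S := by
        rw [mul_pow, mul_pow, Real.sq_sqrt hS0]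
        ring
  calc ∑ i, ‖a i‖ ^ 2 ≤ ∑ _i : Fin 3, 49 * M ^ 2 * S := Finset.sum_le_sum fun i _ => ha i
    _ = 147 * M ^ 2 * S := by
      simp only [Finset.sum_const, Finset.card_univ, Fintype.card_fin, nsmul_eq_mul]
      push_cast
      ring

/-- Uniqueness for the integral equation, with integrals over the whole space. -/
lemma eq_zero_of_eq_volumePotential_add_pd {k : ℝ} (hk : 0 < k) {p : R3 → ℂ} (hp : ContDiff ℝ 2 p)
    (hpc : HasCompactSupport p) (him : ∀ x, 0 ≤ (p x).im) {q : Fin 3 → R3 → ℂ}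
    (hq : ∀ i, ContDiff ℝ 1 (q i)) (hqc : ∀ i, HasCompactSupport (q i))
    (hpq : ∀ i x, pd i p x = ((k : ℂ) ^ 2 + p x) * q i x) {e : Fin 3 → R3 → ℂ}
    (he : ∀ i, ContDiff ℝ 2 (e i))
    (h : ∀ i x, e i x = volumePotential k (fun y => p y * e i y) x +
      pd i (volumePotential k fun y => ∑ j, q j y * e j y) x) (i : Fin 3) (x : R3) :
    e i x = 0 := by
  set m : R3 → ℂ := fun y => ∑ j, q j y * e j y with hm
  have hm1 : ContDiff ℝ 1 m := ContDiff.sum fun j _ => (hq j).mul ((he j).of_le one_le_two)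
  have hmc : HasCompactSupport m := by
    have h1 : ∀ j, HasCompactSupport fun y => q j y * e j y := fun j => (hqc j).mul_right
    simp only [hm, Fin.sum_univ_three]
    exact ((h1 0).add (h1 1)).add (h1 2)
  have hdiv := divergence_eq_neg hk hp hpc him he hm1 hmc
    (fun y => by simp only [hpq, hm, Finset.mul_sum, mul_assoc]) h
  have hV : ∀ i, e i = volumePotential k fun y => p y * e i y + pd i m y := fun i => by
    rw [volumePotential_add (f := fun y => p y * e i y) hpc.mul_right
      (hp.continuous.mul (he i).continuous) (hmc.pd i) (hm1.continuous_pd i one_ne_zero),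
      ← hmc.pd_volumePotential hm1]
    exact funext (h i)
  have hec := hasCompactSupport_of_divergence_eq hk hp hpc him he hm1 hmc hdiv hV
  have hlap : ∀ i y, laplace (e i) y =
      -((k : ℂ) ^ 2 + p y) * e i y - ∑ j, (pd i (q j) y * e j y + q j y * pd i (e j) y) := by
    intro i y
    have h1 := laplace_volumePotential (k := k) (h := fun y => p y * e i y + pd i m y)
      ((hp.continuous.mul (he i).continuous).add (hm1.continuous_pd i one_ne_zero))
      ((hpc.mul_right (f' := e i)).add (hmc.pd i)) (by rw [← hV]; exact he i) y
    rw [← hV] at h1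
    have h2 : pd i m y = ∑ j, (pd i (q j) y * e j y + q j y * pd i (e j) y) := by
      rw [hm, pd_sum Finset.univ (f := fun j y => q j y * e j y)
        (fun j => ((hq j).differentiable one_ne_zero y).mul
        ((he j).differentiable two_ne_zero y))]
      refine Finset.sum_congr rfl fun j _ => ?_
      rw [pd_mul ((hq j).differentiable one_ne_zero y) ((he j).differentiable two_ne_zero y)]
      ring
    rw [h1, ← h2]
    ring
  obtain ⟨Cp, hCp⟩ := hpc.exists_bound_of_continuous hp.continuous
  choose Cq hCq using fun j => (hqc j).exists_bound_of_continuous (hq j).continuous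
  choose Cd hCd using fun i j =>
    ((hqc j).pd i).exists_bound_of_continuous ((hq j).continuous_pd i one_ne_zero)
  have hCp0 : 0 ≤ Cp := (norm_nonneg _).trans (hCp 0)
  have hCq0 : ∀ j, 0 ≤ Cq j := fun j => (norm_nonneg _).trans (hCq j 0)
  have hCd0 : ∀ i j, 0 ≤ Cd i j := fun i j => (norm_nonneg _).trans (hCd i j 0)
  set M := k ^ 2 + Cp + ∑ j, Cq j + ∑ i, ∑ j, Cd i j with hMdef
  have sq0 : 0 ≤ ∑ j, Cq j := Finset.sum_nonneg fun j _ => hCq0 j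
  have sd0 : 0 ≤ ∑ i, ∑ j, Cd i j :=
    Finset.sum_nonneg fun i _ => Finset.sum_nonneg fun j _ => hCd0 i j
  have hk2 : 0 ≤ k ^ 2 := by positivity
  have hM : 0 ≤ M := by positivity
  have hMq : ∀ j, Cq j ≤ M := fun j => by
    have := Finset.single_le_sum (fun j _ => hCq0 j) (Finset.mem_univ j)
    linarith
  have hMd : ∀ i j, Cd i j ≤ M := fun i j => by
    have h1 := Finset.single_le_sum (fun j _ => hCd0 i j) (Finset.mem_univ j)
    have h2 := Finset.single_le_sum (f := fun i => ∑ j, Cd i j)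
      (fun i _ => Finset.sum_nonneg fun j _ => hCd0 i j) (Finset.mem_univ i)
    linarith
  refine eq_zero_of_laplace_le he hec (C := 147 * M ^ 2) (fun y => ?_) i x
  refine sum_sq_le_of_norm_le (a := fun a => laplace (e a) y) (b := fun a => e a y)
    (d := fun a i => pd i (e a) y) hM fun i => ?_
  simp only [hlap]
  refine (norm_sub_le _ _).trans (add_le_add ?_ ((norm_sum_le _ _).trans
    (Finset.sum_le_sum fun j _ => (norm_add_le _ _).trans (add_le_add ?_ ?_))))
  · rw [norm_mul, norm_neg]
    refine mul_le_mul_of_nonneg_right ((norm_add_le _ _).trans ?_) (norm_nonneg _)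
    have h1 : ‖(k : ℂ) ^ 2‖ = k ^ 2 := by simp
    have h2 := hCp y
    linarith
  · rw [norm_mul]
    exact mul_le_mul_of_nonneg_right ((hCd i j y).trans (hMd i j)) (norm_nonneg _)
  · rw [norm_mul]
    exact mul_le_mul_of_nonneg_right ((hCq j y).trans (hMq j)) (norm_nonneg _)

lemma pd_eq_zero_of_forall_notMem {D : Set R3} {f : R3 → ℂ} {c : ℂ} (hf : ∀ x, x ∉ D → f x = c)
    (hfD : ∀ x ∈ frontier D, grad f x = 0) (i : Fin 3) {x : R3} (hx : x ∉ D) : pd i f x = 0 := by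
  by_cases hxc : x ∈ closure D
  · have h1 : x ∈ frontier D := ⟨hxc, fun h => hx (interior_subset h)⟩
    exact congrFun (hfD x h1) i
  · have h1 : f =ᶠ[𝓝 x] fun _ => c := by
      filter_upwards [isClosed_closure.isOpen_compl.mem_nhds hxc] with y hy
      exact hf y fun h => hy (subset_closure h)
    rw [pd, h1.fderiv_eq, fderiv_const_apply]
    rfl

lemma hasCompactSupport_of_forall_notMem {D : Set R3} (hD : Bornology.IsBounded D) {f : R3 → ℂ}
    (hf : ∀ x, x ∉ D → f x = 0) : HasCompactSupport f :=
  HasCompactSupport.intro hD.isCompact_closure fun x hx => hf x fun h => hx (subset_closure h)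

lemma setIntegral_g_mul_eq_volumePotential (k : ℝ) {D : Set R3} {f : R3 → ℂ}
    (hf : ∀ x, x ∉ D → f x = 0) (x : R3) :
    ∫ y in D, g k x y * f y = volumePotential k f x :=
  setIntegral_eq_integral_of_forall_compl_eq_zero fun y hy => by rw [hf y hy, mul_zero]

theorem homogeneous_integral_equation_trivial
    (k : ℝ) (hk : 0 < k) (D : Set R3) (hD : IsOpen D)
    (hDb : Bornology.IsBounded D) (h0D : (0 : R3) ∈ D)
    (K2 : R3 → ℂ) (hK2 : ContDiff ℝ 2 K2) (hK2ne : ∀ x, K2 x ≠ 0)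
    (hK2out : ∀ x, x ∉ D → K2 x = (k : ℂ) ^ 2)
    (hK2im : ∀ x, 0 ≤ (K2 x).im)
    (hK2bd : ∀ x ∈ frontier D, grad K2 x = 0)
    (E : R3 → Fin 3 → ℂ) (hE : ContDiff ℝ 2 E)
    (hinteq : ∀ x : R3, ∀ i : Fin 3,
      E x i = (∫ y in D, g k x y * ((K2 y - (k : ℂ) ^ 2) * E y i))
        + pd i (fun z => ∫ y in D,
            g k z y * dotc (fun j => pd j K2 y / K2 y) (E y)) x) :
    ∀ x, E x = 0 := by
  have hpd : ∀ i x, x ∉ D → pd i K2 x = 0 := fun i x hx =>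
    pd_eq_zero_of_forall_notMem hK2out hK2bd i hx
  have hp0 : ∀ x, x ∉ D → K2 x - (k : ℂ) ^ 2 = 0 := fun x hx => sub_eq_zero.2 (hK2out x hx)
  have hq0 : ∀ i x, x ∉ D → pd i K2 x / K2 x = 0 := fun i x hx => by rw [hpd i x hx, zero_div]
  have hq1 : ∀ i, ContDiff ℝ 1 fun y => pd i K2 y / K2 y := fun i => by
    simp only [div_eq_mul_inv]
    exact (hK2.pd i one_add_one_eq_two.le).mul ((hK2.of_le one_le_two).inv hK2ne)
  intro x
  funext i
  refine eq_zero_of_eq_volumePotential_add_pd hk (p := fun y => K2 y - (k : ℂ) ^ 2)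
    (hK2.sub contDiff_const) (hasCompactSupport_of_forall_notMem hDb hp0) (fun y => ?_)
    (q := fun j y => pd j K2 y / K2 y)
    hq1 (fun j => hasCompactSupport_of_forall_notMem hDb (hq0 j)) (fun j y => ?_)
    (e := fun j y => E y j) (fun j => contDiff_pi.1 hE j) (fun j y => ?_) i x
  · have h1 : ((k : ℂ) ^ 2).im = 0 := by
      rw [← Complex.ofReal_pow, Complex.ofReal_im]
    rw [Complex.sub_im, h1, sub_zero]
    exact hK2im y
  · rw [add_sub_cancel, mul_div_cancel₀ _ (hK2ne y), pd, pd, fderiv_sub_const]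
  · rw [hinteq y j, setIntegral_g_mul_eq_volumePotential k
      (f := fun y => (K2 y - (k : ℂ) ^ 2) * E y j) fun y hy => by rw [hp0 y hy, zero_mul]]
    congr 2
    funext z
    exact setIntegral_g_mul_eq_volumePotential k
      (f := fun y => dotc (fun j => pd j K2 y / K2 y) (E y))
      (fun y hy => Finset.sum_eq_zero fun j _ => mul_eq_zero_of_left (hq0 j y hy) _) z
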